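/- arXiv:1907.08545 — 4 statements merged into one kernel-verified Lean document; each statement's English description precedes it below -/
import Mathlib

section
/- Let 1 ≤ c ≤ n−1 and let X ⊆ ℂ^n be any subset. Then X is positively hyperbolic of codimension c if and only if varbar(Im(x)) ≥ c for every x ∈ X. -/
open Matrix

/-- All maximal (`c × c`) minors of a `c × n` real matrix are positive. -/
def AllMinorsPos {c n : ℕ} (A : Matrix (Fin c) (Fin n) ℝ) : Prop :=
  ∀ s : Fin c → Fin n, StrictMono s → 0 < (A.submatrix id s).det

/-- All maximal (`c × c`) minors of a `c × n` real matrix are nonnegative. -/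
def AllMinorsNonneg {c n : ℕ} (A : Matrix (Fin c) (Fin n) ℝ) : Prop :=
  ∀ s : Fin c → Fin n, StrictMono s → 0 ≤ (A.submatrix id s).det

/-- A `c`-dimensional linear subspace of `ℝⁿ` is positive if it is the row space of a real
`c × n` matrix of rank `c` all of whose `c × c` minors are positive. -/
def IsPositiveSubspace {n : ℕ} (c : ℕ) (L : Submodule ℝ (Fin n → ℝ)) : Prop :=
  ∃ A : Matrix (Fin c) (Fin n) ℝ, A.rank = c ∧
    L = Submodule.span ℝ (Set.range fun i => A i) ∧ AllMinorsPos A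

/-- A `c`-dimensional linear subspace of `ℝⁿ` is nonnegative if it is the row space of a real
`c × n` matrix of rank `c` all of whose `c × c` minors are nonnegative. -/
def IsNonnegSubspace {n : ℕ} (c : ℕ) (L : Submodule ℝ (Fin n → ℝ)) : Prop :=
  ∃ A : Matrix (Fin c) (Fin n) ℝ, A.rank = c ∧
    L = Submodule.span ℝ (Set.range fun i => A i) ∧ AllMinorsNonneg A

/-- Coordinatewise imaginary part of a point of `ℂⁿ`. -/
def imPart {n : ℕ} (x : Fin n → ℂ) : Fin n → ℝ := fun i => (x i).im

/-- A subset of `ℂⁿ` is positively hyperbolic of codimension `c` if the imaginary part of any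
of its points does not lie in `L \ {0}` for any positive `c`-dimensional subspace `L ⊆ ℝⁿ`. -/
def PosHyperbolic {n : ℕ} (c : ℕ) (X : Set (Fin n → ℂ)) : Prop :=
  ∀ L : Submodule ℝ (Fin n → ℝ), IsPositiveSubspace c L →
    ∀ x ∈ X, ¬ (imPart x ∈ L ∧ imPart x ≠ 0)
/-- `var v`: the number of sign changes in the sequence `v 0, …, v (n-1)` after deleting
zeroes.  Equivalently, it is the largest `k` admitting indices `s 0 < s 1 < ⋯ < s k` such
that consecutive chosen entries have (nonzero) opposite signs. -/
noncomputable def var {n : ℕ} (v : Fin n → ℝ) : ℕ :=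
  sSup {k | ∃ s : Fin (k + 1) → Fin n, StrictMono s ∧
    ∀ j : Fin k, v (s j.castSucc) * v (s j.succ) < 0}

/-- `varbar v`: the maximal number of sign changes obtainable by freely reassigning the
entries of `v` that are zero. -/
noncomputable def varbar {n : ℕ} (v : Fin n → ℝ) : ℕ :=
  sSup {k | ∃ w : Fin n → ℝ, (∀ i, v i ≠ 0 → w i = v i) ∧ k = var w}

/-- `v` has `c + 1` entries, in increasing positions, whose signs weakly alternate. -/
def WeaklyAlternates {n : ℕ} (c : ℕ) (v : Fin n → ℝ) : Prop :=
  ∃ s : Fin (c + 1) → Fin n, StrictMono s ∧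
    ∃ ε : ℝ, ε ≠ 0 ∧ ∀ j : Fin (c + 1), 0 ≤ ε * (-1) ^ (j : ℕ) * v (s j)

lemma lt_of_strictMono_fin {n k : ℕ} {s : Fin (k + 1) → Fin n} (hs : StrictMono s) : k < n := by
  simpa using Fintype.card_le_of_injective s hs.injective

lemma bddAbove_var {n : ℕ} (v : Fin n → ℝ) :
    BddAbove {k | ∃ s : Fin (k + 1) → Fin n, StrictMono s ∧
      ∀ j : Fin k, v (s j.castSucc) * v (s j.succ) < 0} :=
  ⟨n, fun _ ⟨_, hs, _⟩ => (lt_of_strictMono_fin hs).le⟩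

lemma le_var {n k : ℕ} {v : Fin n → ℝ} {s : Fin (k + 1) → Fin n} (hs : StrictMono s)
    (h : ∀ j : Fin k, v (s j.castSucc) * v (s j.succ) < 0) : k ≤ var v :=
  le_csSup (bddAbove_var v) ⟨s, hs, h⟩

lemma exists_of_le_var {n c : ℕ} (hn : 0 < n) {v : Fin n → ℝ} (h : c ≤ var v) :
    ∃ s : Fin (c + 1) → Fin n, StrictMono s ∧
      ∀ j : Fin c, v (s j.castSucc) * v (s j.succ) < 0 := by
  have hne : {k | ∃ s : Fin (k + 1) → Fin n, StrictMono s ∧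
      ∀ j : Fin k, v (s j.castSucc) * v (s j.succ) < 0}.Nonempty :=
    ⟨0, fun _ => ⟨0, hn⟩, fun i j hij => by omega, fun j => j.elim0⟩
  obtain ⟨s, hs, h'⟩ := Nat.sSup_mem hne (bddAbove_var v)
  refine ⟨s ∘ Fin.castLE (Nat.succ_le_succ h), hs.comp (Fin.strictMono_castLE _), fun j => ?_⟩
  exact h' (Fin.castLE h j)

lemma var_le {n : ℕ} (hn : 0 < n) (v : Fin n → ℝ) : var v ≤ n := by
  obtain ⟨s, hs, -⟩ := exists_of_le_var hn (le_refl (var v))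
  exact (lt_of_strictMono_fin hs).le

/-- A vector has `varbar` at least `c` iff it has `c + 1` weakly alternating entries. -/
lemma le_varbar_iff {n c : ℕ} (hc : 1 ≤ c) (hn : 0 < n) (v : Fin n → ℝ) :
    c ≤ varbar v ↔ WeaklyAlternates c v := by
  have hbdd : BddAbove {k | ∃ w : Fin n → ℝ, (∀ i, v i ≠ 0 → w i = v i) ∧ k = var w} :=
    ⟨n, fun _ ⟨w, _, hk⟩ => hk ▸ var_le hn w⟩
  constructor
  · intro h
    have hne : {k | ∃ w : Fin n → ℝ, (∀ i, v i ≠ 0 → w i = v i) ∧ k = var w}.Nonempty :=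
      ⟨var v, v, fun _ _ => rfl, rfl⟩
    obtain ⟨w, hw, hvar⟩ := Nat.sSup_mem hne hbdd
    have hcw : c ≤ var w := hvar ▸ h
    obtain ⟨s, hs, halt⟩ := exists_of_le_var hn hcw
    have h0 : w (s 0) ≠ 0 := by
      have := halt ⟨0, hc⟩
      intro h0
      change w (s 0) * _ < 0 at this
      simp [h0] at this
    have key : ∀ j : Fin (c + 1), 0 < w (s 0) * (-1) ^ (j : ℕ) * w (s j) := by
      intro j
      induction j using Fin.induction with
      | zero => simpa using h0
      | succ j ih =>
        refine (mul_pos_iff_of_pos_left ih).1 ?_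
        have h1 : ((-1 : ℝ) ^ (j : ℕ)) ^ 2 = 1 := by simp [← pow_mul]
        have h2 : 0 < w (s 0) ^ 2 := by positivity
        have := halt j
        simp only [Fin.val_succ, Fin.val_castSucc, pow_succ]
        nlinarith [mul_pos h2 (neg_pos.2 this)]
    refine ⟨s, hs, w (s 0), h0, fun j => ?_⟩
    by_cases hv : v (s j) = 0
    · simp [hv]
    · rw [← hw _ hv]
      exact (key j).le
  · rintro ⟨s, hs, ε, hε, h⟩
    classical
    let w : Fin n → ℝ := fun i =>
      if v i = 0 then (if hi : ∃ j, s j = i then ε * (-1) ^ (hi.choose : ℕ) else 0) else v i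
    have hpos : ∀ j : Fin (c + 1), 0 < ε * (-1) ^ (j : ℕ) * w (s j) := by
      intro j
      by_cases hv : v (s j) = 0
      · have hi : ∃ k, s k = s j := ⟨j, rfl⟩
        have hj : hi.choose = j := hs.injective hi.choose_spec
        have : w (s j) = ε * (-1) ^ (j : ℕ) := by
          simp only [w, if_pos hv, dif_pos hi, hj]
        rw [this]
        exact mul_self_pos.2 (mul_ne_zero hε (by simp))
      · have : w (s j) = v (s j) := by simp [w, hv]
        rw [this]
        exact lt_of_le_of_ne (h j) (mul_ne_zero (mul_ne_zero hε (by simp)) hv).symm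
    have hw : c ≤ var w := by
      refine le_var hs fun j => ?_
      have h1 := mul_pos (hpos j.castSucc) (hpos j.succ)
      have h2 : ((-1 : ℝ) ^ (j : ℕ)) ^ 2 = 1 := by simp [← pow_mul]
      have h3 : 0 < ε ^ 2 := by positivity
      simp only [Fin.val_succ, Fin.val_castSucc, pow_succ] at h1
      by_contra hcon
      push Not at hcon
      have : ε * (-1) ^ (j : ℕ) * w (s j.castSucc) * (ε * ((-1) ^ (j : ℕ) * -1) * w (s j.succ))
          = -(((-1 : ℝ) ^ (j : ℕ)) ^ 2 * (ε ^ 2 * (w (s j.castSucc) * w (s j.succ)))) := by ring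
      rw [this, h2] at h1
      nlinarith [mul_nonneg h3.le hcon]
    exact hw.trans (le_csSup hbdd ⟨w, fun i hi => by simp [w, hi], rfl⟩)

lemma eq_zero_of_vecMul_comp_eq_zero {n c : ℕ} {A : Matrix (Fin c) (Fin n) ℝ}
    (hA : AllMinorsPos A) {s : Fin c → Fin n} (hs : StrictMono s) {l : Fin c → ℝ}
    (h : ∀ j, (l ᵥ* A) (s j) = 0) : l = 0 :=
  Matrix.eq_zero_of_vecMul_eq_zero (hA s hs).ne' (funext h)

/-- A nonzero vector in a positive `c`-dimensional subspace has no `c + 1` weakly alternating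
entries. -/
lemma not_weaklyAlternates_of_allMinorsPos {n c : ℕ} {A : Matrix (Fin c) (Fin n) ℝ}
    (hA : AllMinorsPos A) {l : Fin c → ℝ} (hv : l ᵥ* A ≠ 0) :
    ¬ WeaklyAlternates c (l ᵥ* A) := by
  rintro ⟨s, hs, ε, hε, h⟩
  set v := l ᵥ* A with hvdef
  have hs' : ∀ j : Fin (c + 1), StrictMono (s ∘ j.succAbove) :=
    fun j => hs.comp (Fin.strictMono_succAbove j)
  let M : Matrix (Fin (c + 1)) (Fin (c + 1)) ℝ :=
    Matrix.of (Fin.cons (fun j => v (s j)) fun i j => A i (s j))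
  have hM : M.det = 0 := by
    refine Matrix.exists_vecMul_eq_zero_iff.1 ⟨Fin.cons (-1) l, fun h0 => ?_, ?_⟩
    · have := congrFun h0 0
      simp at this
    · ext j
      simp [Matrix.vecMul, dotProduct, Fin.sum_univ_succ, M, hvdef]
  rw [Matrix.det_succ_row_zero] at hM
  have hterm : ∀ j : Fin (c + 1), 0 ≤ ε * ((-1) ^ (j : ℕ) * M 0 j *
      (M.submatrix Fin.succ j.succAbove).det) := by
    intro j
    have : M.submatrix Fin.succ j.succAbove = A.submatrix id (s ∘ j.succAbove) := by
      ext a b; simp [M]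
    rw [this]
    have h2 := mul_nonneg (h j) (hA _ (hs' j)).le
    calc _ ≤ _ := h2
      _ = _ := by simp only [M, Matrix.of_apply, Fin.cons_zero]; ring
  have hsum : ∑ j : Fin (c + 1), ε * ((-1) ^ (j : ℕ) * M 0 j *
      (M.submatrix Fin.succ j.succAbove).det) = 0 := by
    rw [← Finset.mul_sum, hM, mul_zero]
  rw [Finset.sum_eq_zero_iff_of_nonneg fun j _ => hterm j] at hsum
  have hzero : ∀ j, v (s j) = 0 := by
    intro j
    have h1 := hsum j (Finset.mem_univ j)
    have : M.submatrix Fin.succ j.succAbove = A.submatrix id (s ∘ j.succAbove) := by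
      ext a b; simp [M]
    rw [this] at h1
    simpa [hε, (hA _ (hs' j)).ne', M] using h1
  have : l = 0 := eq_zero_of_vecMul_comp_eq_zero hA (hs' 0) fun j => hzero _
  exact hv (by simp [hvdef, this])

lemma rank_eq_of_allMinorsPos {n c : ℕ} (hcn : c ≤ n) {A : Matrix (Fin c) (Fin n) ℝ}
    (hA : AllMinorsPos A) : A.rank = c := by
  have : LinearIndependent ℝ A.row := by
    rw [← Matrix.vecMul_injective_iff]
    refine (injective_iff_map_eq_zero A.vecMulLinear).2 fun l hl => ?_
    exact eq_zero_of_vecMul_comp_eq_zero hA (Fin.strictMono_castLE hcn) fun j => congrFun hl _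
  simpa using this.rank_matrix

/-- A polynomial of degree at most `d` with the same signs as `v` on `0, …, n - 1` and constant
sign `σ` beyond, together with `d + 1` weakly alternating entries of `v` ending in sign `σ`. -/
lemma exists_polynomial_sign_eq (v : ℕ → ℝ) {k : ℕ} (hk0 : ∀ i < k, v i = 0) (hk : v k ≠ 0)
    {n : ℕ} (hn : k + 1 ≤ n) :
    ∃ (p : Polynomial ℝ) (d : ℕ) (σ : ℝ) (s : ℕ → ℕ), p.natDegree ≤ d ∧ σ ≠ 0 ∧
      (∀ i < n, SignType.sign (p.eval (i : ℝ)) = SignType.sign (v i)) ∧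
      (∀ i ≥ n, 0 < σ * p.eval (i : ℝ)) ∧
      (∀ i j, i < j → j ≤ d → s i < s j) ∧ (∀ j ≤ d, s j < n) ∧
      ∀ j ≤ d, 0 ≤ σ * (-1) ^ (d + j) * v (s j) := by
  induction n, hn using Nat.le_induction with
  | base =>
    have hpos : ∀ i ≥ k, 0 < ∏ a ∈ Finset.range k, ((i : ℝ) - a) := by
      intro i hi
      refine Finset.prod_pos fun a ha => sub_pos.2 ?_
      exact_mod_cast (Finset.mem_range.1 ha).trans_le hi
    refine ⟨Polynomial.C (v k) * ∏ a ∈ Finset.range k, (Polynomial.X - Polynomial.C (a : ℝ)),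
      k, v k, id, ?_, hk, ?_, ?_, fun i j hij _ => hij, fun j hj => Nat.lt_succ_of_le hj, ?_⟩
    · refine (Polynomial.natDegree_C_mul_le _ _).trans ?_
      rw [Polynomial.natDegree_finsetProd_X_sub_C_eq_card]
      simp
    · intro i hi
      rcases Nat.lt_succ_iff_lt_or_eq.1 hi with hi | rfl
      · have : ∏ a ∈ Finset.range k, ((i : ℝ) - a) = 0 :=
          Finset.prod_eq_zero (Finset.mem_range.2 hi) (sub_self _)
        simp [Polynomial.eval_prod, this, hk0 i hi]
      · simp [Polynomial.eval_prod, sign_mul, sign_pos (hpos i le_rfl)]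
    · intro i hi
      simp only [Polynomial.eval_mul, Polynomial.eval_C, Polynomial.eval_prod,
        Polynomial.eval_sub, Polynomial.eval_X]
      have := mul_pos (mul_self_pos.2 hk) (hpos i (by omega))
      linarith
    · intro j hj
      rcases hj.lt_or_eq with hj | rfl
      · simp [hk0 j hj]
      · simpa [← two_mul, pow_mul] using mul_self_nonneg (v j)
  | succ n hn ih =>
    obtain ⟨p, d, σ, s, hdeg, hσ, hsign, hlarge, hmono, hlt, halt⟩ := ih
    have hpn := hlarge n le_rfl
    by_cases hsame : 0 < σ * v n
    · refine ⟨p, d, σ, s, hdeg, hσ, fun i hi => ?_, fun i hi => hlarge i (by omega), hmono,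
        fun j hj => (hlt j hj).trans (Nat.lt_succ_self n), halt⟩
      rcases Nat.lt_succ_iff_lt_or_eq.1 hi with hi | rfl
      · exact hsign i hi
      · have h1 := sign_pos hpn
        have h2 := sign_pos hsame
        rw [sign_mul] at h1 h2
        exact mul_left_cancel₀ (sign_ne_zero.2 hσ) (h1.trans h2.symm)
    · push Not at hsame
      -- multiply by `r - X`, with the root `r` at `n` or just below it
      obtain ⟨r, hr1, hr2, hr⟩ : ∃ r : ℝ, (n : ℝ) - 1 < r ∧ r ≤ n ∧
          SignType.sign ((r - n) * p.eval (n : ℝ)) = SignType.sign (v n) := by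
        by_cases hv : v n = 0
        · exact ⟨n, by linarith, le_rfl, by simp [hv]⟩
        · refine ⟨n - 1 / 2, by linarith, by linarith, ?_⟩
          have hneg := sign_neg (lt_of_le_of_ne hsame (mul_ne_zero hσ hv))
          have h1 := sign_pos hpn
          rw [sign_mul] at hneg h1
          refine mul_left_cancel₀ (sign_ne_zero.2 hσ) ?_
          rw [sign_mul, mul_left_comm, h1, hneg,
            sign_neg (by linarith : (n : ℝ) - 1 / 2 - n < 0), mul_one]
      refine ⟨(Polynomial.C r - Polynomial.X) * p, d + 1, -σ, Function.update s (d + 1) n,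
        ?_, neg_ne_zero.2 hσ, ?_, ?_, ?_, ?_, ?_⟩
      · refine Polynomial.natDegree_mul_le.trans ?_
        have : (Polynomial.C r - Polynomial.X).natDegree ≤ 1 :=
          (Polynomial.natDegree_sub_le _ _).trans (by simp)
        omega
      · intro i hi
        simp only [Polynomial.eval_mul, Polynomial.eval_C, Polynomial.eval_sub,
          Polynomial.eval_X]
        rcases Nat.lt_succ_iff_lt_or_eq.1 hi with hi | rfl
        · have : (i : ℝ) + 1 ≤ n := by exact_mod_cast hi
          rw [sign_mul, sign_pos (by linarith), one_mul, hsign i hi]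
        · exact hr
      · intro i hi
        have : (n : ℝ) + 1 ≤ i := by exact_mod_cast hi
        have h1 := mul_pos (by linarith : 0 < (i : ℝ) - r) (hlarge i (by omega))
        simp only [Polynomial.eval_mul, Polynomial.eval_C, Polynomial.eval_sub,
          Polynomial.eval_X]
        linarith
      · intro i j hij hj
        rw [Function.update_of_ne (by omega : i ≠ d + 1)]
        rcases hj.lt_or_eq with hj | rfl
        · rw [Function.update_of_ne (by omega)]
          exact hmono i j hij (by omega)
        · simpa using hlt i (by omega)
      · intro j hj
        rcases hj.lt_or_eq with hj | rfl
        · rw [Function.update_of_ne (by omega)]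
          exact (hlt j (by omega)).trans (Nat.lt_succ_self n)
        · simp
      · intro j hj
        rcases hj.lt_or_eq with hj | rfl
        · rw [Function.update_of_ne (by omega)]
          have := halt j (by omega)
          rw [show d + 1 + j = d + j + 1 by ring, pow_succ]
          linarith
        · have h1 : (-1 : ℝ) ^ (d + 1 + (d + 1)) = 1 := by simp [← two_mul, pow_mul]
          rw [Function.update_self, h1]
          linarith

/-- A nonzero vector without `c + 1` weakly alternating entries lies in the row space of a
matrix with positive maximal minors, namely a Vandermonde matrix with rescaled columns. -/
lemma exists_allMinorsPos_vecMul_eq {n c : ℕ} {v : Fin n → ℝ} (hv : v ≠ 0)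
    (h : ¬ WeaklyAlternates c v) :
    ∃ A : Matrix (Fin c) (Fin n) ℝ, AllMinorsPos A ∧ ∃ l : Fin c → ℝ, l ᵥ* A = v := by
  classical
  let u : ℕ → ℝ := fun i => if hi : i < n then v ⟨i, hi⟩ else 0
  have hu : ∀ i : Fin n, u i = v i := fun i => by simp [u]
  have hex : ∃ k, u k ≠ 0 := by
    obtain ⟨i, hi⟩ := Function.ne_iff.1 hv
    exact ⟨i, by rwa [hu]⟩
  have hkn : Nat.find hex + 1 ≤ n := by
    by_contra hcon
    exact Nat.find_spec hex (dif_neg (by omega))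
  obtain ⟨p, d, σ, s, hdeg, hσ, hsign, -, hmono, hlt, halt⟩ := exists_polynomial_sign_eq u
    (fun i hi => not_not.1 (Nat.find_min hex hi)) (Nat.find_spec hex) hkn
  have hdc : d < c := by
    by_contra! hcd
    refine h ⟨fun j => ⟨s j, hlt j (by omega)⟩, fun i j hij => hmono i j hij (by omega),
      σ * (-1) ^ d, mul_ne_zero hσ (by simp), fun j => ?_⟩
    rw [mul_assoc σ, ← pow_add, ← hu]
    exact halt j (by omega)
  have hscale : ∀ i : Fin n, ∃ D : ℝ, 0 < D ∧ D * p.eval (i : ℝ) = v i := by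
    intro i
    have hs := hsign i i.2
    rw [hu] at hs
    by_cases hvi : v i = 0
    · rw [hvi, sign_zero, sign_eq_zero_iff] at hs
      exact ⟨1, one_pos, by rw [hs, hvi, mul_zero]⟩
    · have hp : p.eval (i : ℝ) ≠ 0 := by
        rwa [← sign_ne_zero, hs, sign_ne_zero]
      refine ⟨v i / p.eval (i : ℝ), ?_, div_mul_cancel₀ _ hp⟩
      rcases lt_or_gt_of_ne hvi with hneg | hpos
      · rw [sign_neg hneg, sign_eq_neg_one_iff] at hs
        exact div_pos_of_neg_of_neg hneg hs
      · rw [sign_pos hpos, sign_eq_one_iff] at hs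
        exact div_pos hpos hs
  choose D hD hDv using hscale
  refine ⟨Matrix.of fun k i => D i * (i : ℝ) ^ (k : ℕ), fun t ht => ?_, fun k => p.coeff k, ?_⟩
  · have : (Matrix.of fun (k : Fin c) (i : Fin n) => D i * (i : ℝ) ^ (k : ℕ)).submatrix id t =
        Matrix.of fun k j => D (t j) *
          ((Matrix.vandermonde fun j => ((t j : ℕ) : ℝ))ᵀ : Matrix (Fin c) (Fin c) ℝ) k j := by
      ext k j
      simp [Matrix.vandermonde]
    rw [this, Matrix.det_mul_row, Matrix.det_transpose, Matrix.det_vandermonde]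
    refine mul_pos (Finset.prod_pos fun j _ => hD _)
      (Finset.prod_pos fun i _ => Finset.prod_pos fun j hj => sub_pos.2 ?_)
    exact_mod_cast ht (Finset.mem_Ioi.1 hj)
  · ext i
    rw [← hDv i, Polynomial.eval_eq_sum_range' (hdeg.trans_lt hdc), Finset.mul_sum,
      Finset.sum_range]
    simp only [Matrix.vecMul, dotProduct, Matrix.of_apply]
    exact Finset.sum_congr rfl fun k _ => by ring

lemma mem_span_rows_iff {n c : ℕ} (A : Matrix (Fin c) (Fin n) ℝ) (v : Fin n → ℝ) :
    v ∈ Submodule.span ℝ (Set.range fun i => A i) ↔ ∃ l : Fin c → ℝ, l ᵥ* A = v := by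
  rw [Submodule.mem_span_range_iff_exists_fun]
  simp only [Matrix.vecMul_eq_sum]

/-- A subset `X ⊆ ℂⁿ` is positively hyperbolic of codimension `c` if and
only if `varbar (Im x) ≥ c` for every `x ∈ X`. -/
theorem stmt1 {n c : ℕ} (hc1 : 1 ≤ c) (hc2 : c ≤ n - 1) (X : Set (Fin n → ℂ)) :
    PosHyperbolic c X ↔ ∀ x ∈ X, c ≤ varbar (imPart x) := by
  have hn : 0 < n := by omega
  have hcn : c < n := by omega
  simp only [le_varbar_iff hc1 hn]
  constructor
  · intro hX x hx
    by_contra hcon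
    have hne : imPart x ≠ 0 := fun h0 =>
      hcon ⟨Fin.castLE hcn, Fin.strictMono_castLE _, 1, one_ne_zero, fun j => by simp [h0]⟩
    obtain ⟨A, hA, hl⟩ := exists_allMinorsPos_vecMul_eq hne hcon
    exact hX _ ⟨A, rank_eq_of_allMinorsPos hcn.le hA, rfl, hA⟩ x hx
      ⟨(mem_span_rows_iff A _).2 hl, hne⟩
  · rintro hX L ⟨A, -, rfl, hA⟩ x hx ⟨hmem, hne⟩
    obtain ⟨l, hl⟩ := (mem_span_rows_iff A _).1 hmem
    have := hX x hx
    rw [← hl] at hne this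
    exact not_weaklyAlternates_of_allMinorsPos hA hne this
end

section
/- Let 1 ≤ c ≤ n−1, let P ⊆ ℂ[x_1, …, x_n] be a prime ideal, and let X = {z ∈ ℂ^n : p(z) = 0 for all p ∈ P} be its zero locus. Assume that no coordinate function is constant on X, i.e. x_i − a ∉ P for every i ∈ [n] and every a ∈ ℂ (in particular X is irreducible and not contained in any coordinate hyperplane). Then X is positively hyperbolic of codimension c if and only if for every positive c-dimensional linear subspace L ⊆ ℝ^n and every x ∈ X with Im(x_i) ≠ 0 for all i ∈ [n], we have Im(x) ∉ L. -/
open Matrix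

/-- A univariate polynomial over `ℂ[y₁, …, y_d]` which has, at every point of some open ball, a real
root after specialisation of the coefficients, has a constant root. -/
theorem exists_constant_root_of_real_root {d : ℕ} {G : Polynomial (MvPolynomial (Fin d) ℂ)}
    (hG : G.Monic) (b : Fin d → ℂ) {δ : ℝ} (hδ : 0 < δ)
    (h : ∀ b', dist b' b < δ → ∃ t : ℝ, (G.map (MvPolynomial.eval b')).eval (t : ℂ) = 0) :
    ∃ t : ℂ, G.eval (MvPolynomial.C t) = 0 := by
  classical
  let φ : MvPolynomial (Fin d) ℂ →+* MvPolynomial (Fin d ⊕ Fin d) ℂ :=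
    MvPolynomial.eval₂Hom MvPolynomial.C fun j =>
      MvPolynomial.X (Sum.inl j) + MvPolynomial.C Complex.I * MvPolynomial.X (Sum.inr j)
  let ψ : MvPolynomial (Fin d) ℂ →+* MvPolynomial (Fin d ⊕ Fin d) ℂ :=
    MvPolynomial.eval₂Hom (MvPolynomial.C.comp (starRingEnd ℂ)) fun j =>
      MvPolynomial.X (Sum.inl j) - MvPolynomial.C Complex.I * MvPolynomial.X (Sum.inr j)
  have hφ (z : Fin d ⊕ Fin d → ℂ) : (MvPolynomial.eval z).comp φ =
      MvPolynomial.eval fun j => z (Sum.inl j) + Complex.I * z (Sum.inr j) := by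
    apply MvPolynomial.ringHom_ext <;> simp [φ]
  have hψ (z : Fin d ⊕ Fin d → ℂ) : (MvPolynomial.eval z).comp ψ =
      MvPolynomial.eval₂Hom (starRingEnd ℂ)
        fun j => z (Sum.inl j) - Complex.I * z (Sum.inr j) := by
    apply MvPolynomial.ringHom_ext <;> simp [ψ]
  have hres (z : Fin d ⊕ Fin d → ℂ) :
      MvPolynomial.eval z (Polynomial.resultant (G.map φ) (G.map ψ)) = 0 ↔
        ∃ t : ℂ, (G.map (MvPolynomial.eval
            fun j => z (Sum.inl j) + Complex.I * z (Sum.inr j))).eval t = 0 ∧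
          (G.map (MvPolynomial.eval₂Hom (starRingEnd ℂ)
            fun j => z (Sum.inl j) - Complex.I * z (Sum.inr j))).eval t = 0 := by
    rw [← Polynomial.resultant_map_map, Polynomial.map_map, Polynomial.map_map, hφ, hψ,
      hG.natDegree_map, hG.natDegree_map]
    have e1 := hG.natDegree_map (MvPolynomial.eval
            fun j => z (Sum.inl j) + Complex.I * z (Sum.inr j))
    have e2 := hG.natDegree_map (MvPolynomial.eval₂Hom (starRingEnd ℂ)
            fun j => z (Sum.inl j) - Complex.I * z (Sum.inr j))
    conv_lhs => rw [← e1]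
    conv_lhs => enter [1, 4]; rw [e1, ← e2]
    rw [Polynomial.resultant_eq_zero_iff,
      Polynomial.isCoprime_iff_aeval_ne_zero_of_isAlgClosed (K := ℂ) (k := ℂ)]
    simp [(hG.map _).ne_zero]
  have hzero : Polynomial.resultant (G.map φ) (G.map ψ) = 0 := by
    refine MvPolynomial.funext_set
      (Sum.elim (fun j => Complex.ofReal '' Set.Ioo ((b j).re - δ / 2) ((b j).re + δ / 2))
        fun j => Complex.ofReal '' Set.Ioo ((b j).im - δ / 2) ((b j).im + δ / 2)) ?_ ?_
    · rintro (j | j) <;>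
        exact (Set.Ioo_infinite (by linarith)).image Complex.ofReal_injective.injOn
    · intro z hz
      rw [map_zero, hres]
      have hl (j : Fin d) := hz (Sum.inl j) trivial
      have hr (j : Fin d) := hz (Sum.inr j) trivial
      simp only [Sum.elim_inl, Sum.elim_inr, Set.mem_image] at hl hr
      choose u hu hu' using hl
      choose v hv hv' using hr
      obtain ⟨t, ht⟩ := h (fun j => z (Sum.inl j) + Complex.I * z (Sum.inr j)) (by
        rw [dist_pi_lt_iff hδ]
        intro j
        rw [← hu', ← hv', Complex.dist_eq]
        refine (Complex.norm_le_abs_re_add_abs_im _).trans_lt ?_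
        have h1 : |u j - (b j).re| < δ / 2 :=
          abs_lt.2 ⟨by linarith [(hu j).1], by linarith [(hu j).2]⟩
        have h2 : |v j - (b j).im| < δ / 2 :=
          abs_lt.2 ⟨by linarith [(hv j).1], by linarith [(hv j).2]⟩
        simp
        linarith)
      refine ⟨t, ht, ?_⟩
      have : (MvPolynomial.eval₂Hom (starRingEnd ℂ)
          fun j => z (Sum.inl j) - Complex.I * z (Sum.inr j)) =
          (starRingEnd ℂ).comp (MvPolynomial.eval
            fun j => z (Sum.inl j) + Complex.I * z (Sum.inr j)) := by
        apply MvPolynomial.ringHom_ext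
        · simp
        · intro j
          simp [← hu', ← hv', sub_eq_add_neg]
      rw [this, ← Polynomial.map_map]
      have h3 := Polynomial.eval_map_apply (starRingEnd ℂ) (t : ℂ) (p := G.map (MvPolynomial.eval
            fun j => z (Sum.inl j) + Complex.I * z (Sum.inr j)))
      rw [Complex.conj_ofReal] at h3
      rw [h3, ht, map_zero]
  set H := G.map (MvPolynomial.eval₂Hom (starRingEnd ℂ) fun _ => (0 : ℂ)) with hH
  have hprod : ∏ t ∈ H.roots.toFinset, G.eval (MvPolynomial.C t) = 0 := by
    apply MvPolynomial.funext
    intro p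
    obtain ⟨t, ht, ht'⟩ := (hres (Sum.elim (fun j => p j / 2)
      fun j => -Complex.I * p j / 2)).1 (by rw [hzero, map_zero])
    have e1 : (fun j => p j / 2 + Complex.I * (-Complex.I * p j / 2)) = p := by
      funext j
      linear_combination (-p j / 2) * Complex.I_sq
    have e2 : (fun j => p j / 2 - Complex.I * (-Complex.I * p j / 2)) = fun _ => 0 := by
      funext j
      linear_combination (p j / 2) * Complex.I_sq
    simp only [Sum.elim_inl, Sum.elim_inr, e1, e2] at ht ht'
    rw [map_prod, map_zero]
    refine Finset.prod_eq_zero (i := t) ?_ ?_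
    · simpa [(hG.map _).ne_zero, hH] using ht'
    · rw [← ht, ← Polynomial.eval_map_apply, MvPolynomial.eval_C]
  obtain ⟨t, -, ht⟩ := Finset.prod_eq_zero_iff.1 hprod
  exact ⟨t, ht⟩

/-- Noether normalization of an affine variety, in terms of points: `Y` are the coordinates of the
finite projection and `G F` is the minimal polynomial of `F` over the polynomial ring in `Y`. -/
theorem exists_noether_projection {n : ℕ} (P : Ideal (MvPolynomial (Fin n) ℂ)) [P.IsPrime] :
    ∃ (d : ℕ) (Y : Fin d → MvPolynomial (Fin n) ℂ)
      (G : MvPolynomial (Fin n) ℂ → Polynomial (MvPolynomial (Fin d) ℂ)),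
      ∀ F, (G F).Monic ∧
        (∀ x ∈ MvPolynomial.zeroLocus ℂ P,
          ((G F).map (MvPolynomial.eval fun j => MvPolynomial.eval x (Y j))).eval
            (MvPolynomial.eval x F) = 0) ∧
        (∀ (b : Fin d → ℂ) (t : ℂ), ((G F).map (MvPolynomial.eval b)).eval t = 0 →
          ∃ x ∈ MvPolynomial.zeroLocus ℂ P,
            (∀ j, MvPolynomial.eval x (Y j) = b j) ∧ MvPolynomial.eval x F = t) ∧
        ∀ t : ℂ, (G F).eval (MvPolynomial.C t) = 0 → F - MvPolynomial.C t ∈ P := by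
  obtain ⟨d, -, g, hg, hint⟩ := exists_integral_inj_algHom_of_quotient P Ideal.IsPrime.ne_top'
  choose Y hY using fun j => Ideal.Quotient.mk_surjective (g (MvPolynomial.X j))
  let alg : Algebra (MvPolynomial (Fin d) ℂ) (MvPolynomial (Fin n) ℂ ⧸ P) :=
    g.toRingHom.toAlgebra
  have halg (p) : algebraMap (MvPolynomial (Fin d) ℂ) (MvPolynomial (Fin n) ℂ ⧸ P) p = g p := rfl
  have : FaithfulSMul (MvPolynomial (Fin d) ℂ) (MvPolynomial (Fin n) ℂ ⧸ P) :=
    (faithfulSMul_iff_algebraMap_injective _ _).2 hg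
  have hI : Algebra.IsIntegral (MvPolynomial (Fin d) ℂ) (MvPolynomial (Fin n) ℂ ⧸ P) := ⟨hint⟩
  refine ⟨d, Y, fun F => minpoly _ (Ideal.Quotient.mk P F), fun F => ?_⟩
  set a := Ideal.Quotient.mk P F with ha
  have hmonic := minpoly.monic (hI.isIntegral a)
  refine ⟨hmonic, ?_, ?_, ?_⟩
  · intro x hx
    let e : MvPolynomial (Fin n) ℂ ⧸ P →+* ℂ := Ideal.Quotient.lift P (MvPolynomial.eval x)
      fun p hp => by simpa [MvPolynomial.aeval_eq_eval] using hx p hp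
    have hmk (p) : e (Ideal.Quotient.mk P p) = MvPolynomial.eval x p := rfl
    have he : e.comp (algebraMap (MvPolynomial (Fin d) ℂ) _) =
        MvPolynomial.eval fun j => MvPolynomial.eval x (Y j) := by
      apply MvPolynomial.ringHom_ext
      · intro r
        have : g (MvPolynomial.C r) = Ideal.Quotient.mk P (MvPolynomial.C r) := by
          rw [← MvPolynomial.algebraMap_eq, g.commutes]; rfl
        simp [halg, this, hmk]
      · intro j
        simp [halg, ← hY, hmk]
    have h := congrArg e (minpoly.aeval (MvPolynomial (Fin d) ℂ) a)
    rw [map_zero, Polynomial.aeval_def, Polynomial.hom_eval₂, he] at h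
    rwa [Polynomial.eval_map]
  · intro b t hbt
    let θ : Polynomial (MvPolynomial (Fin d) ℂ) →+* ℂ :=
      Polynomial.eval₂RingHom (MvPolynomial.eval b) t
    have hθ : Function.Surjective θ := fun z => ⟨Polynomial.C (MvPolynomial.C z), by simp [θ]⟩
    have hmax : (RingHom.ker θ).IsMaximal := RingHom.ker_isMaximal_of_surjective θ hθ
    let alg' : Algebra (Polynomial (MvPolynomial (Fin d) ℂ)) (MvPolynomial (Fin n) ℂ ⧸ P) :=
      (Polynomial.aeval a).toRingHom.toAlgebra
    have halg' (p) : algebraMap (Polynomial (MvPolynomial (Fin d) ℂ))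
      (MvPolynomial (Fin n) ℂ ⧸ P) p = Polynomial.aeval a p := rfl
    have : IsScalarTower (MvPolynomial (Fin d) ℂ) (Polynomial (MvPolynomial (Fin d) ℂ))
        (MvPolynomial (Fin n) ℂ ⧸ P) := IsScalarTower.of_algebraMap_eq fun p => by
      rw [halg', ← Polynomial.C_eq_algebraMap, Polynomial.aeval_C]
    have : Algebra.IsIntegral (Polynomial (MvPolynomial (Fin d) ℂ)) (MvPolynomial (Fin n) ℂ ⧸ P) :=
      Algebra.IsIntegral.tower_top (MvPolynomial (Fin d) ℂ)
    obtain ⟨Q, hQ, hQc⟩ := Ideal.exists_ideal_over_maximal_of_isIntegral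
      (S := MvPolynomial (Fin n) ℂ ⧸ P) (RingHom.ker θ) (by
        intro p hp
        rw [RingHom.mem_ker, halg'] at hp
        obtain ⟨q, rfl⟩ := minpoly.isIntegrallyClosed_dvd (hI.isIntegral a) hp
        have hbt' : θ (minpoly _ a) = 0 := by rwa [Polynomial.eval_map] at hbt
        rw [RingHom.mem_ker, map_mul, hbt', zero_mul])
    have hmem (p) (hp : θ p = 0) : Polynomial.aeval a p ∈ Q := by
      have : p ∈ RingHom.ker θ := hp
      rwa [← hQc, Ideal.mem_comap, halg'] at this
    have hQ' : (Q.comap (Ideal.Quotient.mk P)).IsMaximal :=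
      Ideal.comap_isMaximal_of_surjective _ Ideal.Quotient.mk_surjective
    obtain ⟨x, hx⟩ := MvPolynomial.isMaximal_iff_eq_vanishingIdeal_singleton.1 hQ'
    have hev (p) (hp : Ideal.Quotient.mk P p ∈ Q) : MvPolynomial.eval x p = 0 := by
      have : p ∈ Q.comap (Ideal.Quotient.mk P) := hp
      rw [hx, MvPolynomial.mem_vanishingIdeal_iff] at this
      simpa [MvPolynomial.aeval_eq_eval] using this x rfl
    refine ⟨x, fun p hp => ?_, fun j => ?_, ?_⟩
    · simpa [MvPolynomial.aeval_eq_eval] using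
        hev p (by rw [Ideal.Quotient.eq_zero_iff_mem.2 hp]; exact Q.zero_mem)
    · have h := hmem (Polynomial.C (MvPolynomial.X j - MvPolynomial.C (b j))) (by simp [θ])
      rw [Polynomial.aeval_C, halg, map_sub, ← hY, ← MvPolynomial.algebraMap_eq, g.commutes] at h
      have := hev (Y j - MvPolynomial.C (b j)) (by rw [map_sub]; exact h)
      simpa [sub_eq_zero] using this
    · have h := hmem (Polynomial.X - Polynomial.C (MvPolynomial.C t)) (by simp [θ])
      rw [map_sub, Polynomial.aeval_X, Polynomial.aeval_C, halg, ← MvPolynomial.algebraMap_eq,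
        g.commutes] at h
      have := hev (F - MvPolynomial.C t) (by rw [map_sub]; exact h)
      simpa [sub_eq_zero] using this
  · intro t ht
    have hdvd := Polynomial.dvd_iff_isRoot.2 ht
    have hassoc := (Polynomial.irreducible_X_sub_C (MvPolynomial.C t)).associated_of_dvd
      (minpoly.irreducible (hI.isIntegral a)) hdvd
    have heq := Polynomial.eq_of_monic_of_associated (Polynomial.monic_X_sub_C _) hmonic hassoc
    have h := minpoly.aeval (MvPolynomial (Fin d) ℂ) a
    rw [← heq, map_sub, Polynomial.aeval_X, Polynomial.aeval_C, halg, ← MvPolynomial.algebraMap_eq,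
      g.commutes] at h
    rw [← Ideal.Quotient.eq_zero_iff_mem, map_sub]
    exact h

/-- A monic complex polynomial with a small constant coefficient has a small root. -/
theorem Polynomial.Monic.exists_root_norm_lt {p : Polynomial ℂ} (hp : p.Monic)
    {η : ℝ} (hη : 0 < η) (h : ‖p.coeff 0‖ < η ^ p.natDegree) :
    ∃ t, p.eval t = 0 ∧ ‖t‖ < η := by
  by_contra! hroots
  have hs := IsAlgClosed.splits p
  rw [hs.coeff_zero_eq_prod_roots_of_monic hp, norm_mul, norm_pow, norm_neg, norm_one, one_pow,
    one_mul] at h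
  refine h.not_ge ?_
  rw [hs.natDegree_eq_card_roots]
  have key : ∀ s : Multiset ℂ, (∀ t ∈ s, η ≤ ‖t‖) → η ^ Multiset.card s ≤ ‖s.prod‖ := by
    intro s
    induction s using Multiset.induction_on with
    | empty => simp
    | cons a s ih =>
      intro hs
      rw [Multiset.card_cons, Multiset.prod_cons, norm_mul, pow_succ']
      exact mul_le_mul (hs a (Multiset.mem_cons_self a s))
        (ih fun t ht => hs t (Multiset.mem_cons_of_mem ht)) (by positivity) (norm_nonneg _)
  exact key _ fun t ht => hroots t (Polynomial.isRoot_of_mem_roots ht)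

/-- A root of a monic polynomial is bounded in terms of the coefficients. -/
theorem Polynomial.Monic.norm_root_le {p : Polynomial ℂ} (hp : p.Monic) {t : ℂ}
    (ht : p.eval t = 0) : ‖t‖ ≤ 1 + ∑ i ∈ Finset.range p.natDegree, ‖p.coeff i‖ := by
  have h : ‖t‖ < p.cauchyBound := by
    exact_mod_cast Polynomial.IsRoot.norm_lt_cauchyBound hp.ne_zero ht
  refine h.le.trans ?_
  rw [Polynomial.cauchyBound, hp.leadingCoeff, nnnorm_one, div_one, add_comm]
  push_cast
  gcongr
  have : Finset.sup (Finset.range p.natDegree) (fun i => ‖p.coeff i‖₊) ≤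
      ∑ i ∈ Finset.range p.natDegree, ‖p.coeff i‖₊ :=
    Finset.sup_le fun i hi => Finset.single_le_sum (f := fun i => ‖p.coeff i‖₊)
      (fun _ _ => zero_le) hi
  simpa using NNReal.coe_le_coe.2 this

/-- A polynomial separating a point from a finite set. -/
theorem MvPolynomial.exists_eval_eq_zero_ne_zero {n : ℕ} (S : Set (Fin n → ℂ)) (hS : S.Finite)
    (x : Fin n → ℂ) : ∃ W : MvPolynomial (Fin n) ℂ, MvPolynomial.eval x W = 0 ∧
      ∀ z ∈ S, MvPolynomial.eval z W = 0 → z = x := by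
  classical
  have hl (z : Fin n → ℂ) : ∃ l : MvPolynomial (Fin n) ℂ,
      z ≠ x → MvPolynomial.eval x l = 1 ∧ MvPolynomial.eval z l = 0 := by
    by_cases hz : z = x
    · exact ⟨0, fun h => absurd hz h⟩
    · obtain ⟨i, hi⟩ := Function.ne_iff.1 hz
      refine ⟨MvPolynomial.C (x i - z i)⁻¹ * (MvPolynomial.X i - MvPolynomial.C (z i)), fun _ => ?_⟩
      have : x i - z i ≠ 0 := sub_ne_zero.2 (Ne.symm hi)
      simp [this]
  choose l hl using hl
  refine ⟨1 - ∏ z ∈ hS.toFinset.erase x, l z, ?_, fun z hz h => ?_⟩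
  · rw [map_sub, map_one, map_prod, Finset.prod_eq_one, sub_self]
    exact fun z hz => (hl z (Finset.ne_of_mem_erase hz)).1
  · by_contra hzx
    rw [map_sub, map_one, map_prod, Finset.prod_eq_zero (i := z), sub_zero] at h
    · exact one_ne_zero h
    · simpa [hzx] using hz
    · exact (hl z hzx).2

/-- Every Euclidean neighbourhood of a point of an irreducible affine variety contains a point at
which a given nonconstant polynomial function takes a nonreal value. -/
theorem exists_mem_zeroLocus_im_ne_zero {n : ℕ} (P : Ideal (MvPolynomial (Fin n) ℂ)) [P.IsPrime]
    (F : MvPolynomial (Fin n) ℂ) (hF : ∀ t : ℂ, F - MvPolynomial.C t ∉ P) {x : Fin n → ℂ}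
    (hx : x ∈ MvPolynomial.zeroLocus ℂ P) {ε : ℝ} (hε : 0 < ε) :
    ∃ x' ∈ MvPolynomial.zeroLocus ℂ P, dist x' x < ε ∧ (MvPolynomial.eval x' F).im ≠ 0 := by
  obtain ⟨d, Y, G, hG⟩ := exists_noether_projection P
  set p : (Fin n → ℂ) → Fin d → ℂ := fun z j => MvPolynomial.eval z (Y j) with hp
  have hpc : Continuous p := continuous_pi fun j => MvPolynomial.continuous_eval (Y j)
  suffices hopen : ∃ δ > 0, ∀ b, dist b (p x) < δ →
      ∃ x' ∈ MvPolynomial.zeroLocus ℂ P, p x' = b ∧ dist x' x < ε by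
    obtain ⟨δ, hδ, h⟩ := hopen
    by_contra! hreal
    obtain ⟨t, ht⟩ := exists_constant_root_of_real_root (hG F).1 (p x) hδ (by
      intro b hb
      obtain ⟨x', hx', rfl, hd⟩ := h b hb
      refine ⟨(MvPolynomial.eval x' F).re, ?_⟩
      have : (((MvPolynomial.eval x' F).re : ℝ) : ℂ) = MvPolynomial.eval x' F :=
        Complex.ext (by simp) (by simp [hreal x' hx' hd])
      rw [this]
      exact (hG F).2.1 x' hx')
    exact hF t ((hG F).2.2.2 t ht)
  have hclosed : IsClosed (MvPolynomial.zeroLocus ℂ P : Set (Fin n → ℂ)) := by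
    have : (MvPolynomial.zeroLocus ℂ P : Set (Fin n → ℂ)) =
        ⋂ q ∈ P, {z | MvPolynomial.eval z q = 0} := by
      ext z; simp [MvPolynomial.aeval_eq_eval]
    rw [this]
    exact isClosed_biInter fun q _ =>
      isClosed_eq (MvPolynomial.continuous_eval q) continuous_const
  have hfin : {z | z ∈ MvPolynomial.zeroLocus ℂ P ∧ p z = p x}.Finite := by
    refine (Set.Finite.pi (t := fun i => {t : ℂ | ((G (MvPolynomial.X i)).map
      (MvPolynomial.eval (p x))).IsRoot t}) fun i =>
        Polynomial.finite_setOfPred_isRoot ((hG _).1.map _).ne_zero).subset ?_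
    rintro z ⟨hz, hzx⟩ i -
    have := (hG (MvPolynomial.X i)).2.1 z hz
    rw [MvPolynomial.eval_X] at this
    change ((G (MvPolynomial.X i)).map (MvPolynomial.eval (p z))).eval (z i) = 0 at this
    rwa [hzx] at this
  obtain ⟨W, hWx, hW⟩ := MvPolynomial.exists_eval_eq_zero_ne_zero _ hfin x
  obtain ⟨hWm, hWr, hWl, -⟩ := hG W
  have hWx0 := hWr x hx
  rw [hWx] at hWx0
  by_contra! hno
  have hseq (k : ℕ) : ∃ z ∈ MvPolynomial.zeroLocus ℂ P, dist (p z) (p x) < 1 / (k + 1) ∧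
      ‖MvPolynomial.eval z W‖ < 1 / (k + 1) ∧ ε ≤ dist z x := by
    have hk : (0 : ℝ) < 1 / (k + 1) := by positivity
    have hcont : Continuous fun b : Fin d → ℂ => ‖MvPolynomial.eval b ((G W).coeff 0)‖ :=
      (MvPolynomial.continuous_eval _).norm
    have h0 : ‖MvPolynomial.eval (p x) ((G W).coeff 0)‖ < (1 / (k + 1) : ℝ) ^ (G W).natDegree := by
      rw [← Polynomial.coeff_zero_eq_eval_zero, Polynomial.coeff_map] at hWx0
      rw [hWx0, norm_zero]
      positivity
    obtain ⟨δ, hδ, hball⟩ := Metric.eventually_nhds_iff.1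
      (hcont.continuousAt.eventually_lt_const h0)
    obtain ⟨b, hb, hbno⟩ := hno (min δ (1 / (k + 1))) (lt_min hδ hk)
    obtain ⟨t, ht, htk⟩ := (hWm.map (MvPolynomial.eval b)).exists_root_norm_lt hk (by
        rw [hWm.natDegree_map, Polynomial.coeff_map]
        exact hball (hb.trans_le (min_le_left _ _)))
    obtain ⟨z, hz, hzb, hzt⟩ := hWl b t ht
    have hpz : p z = b := funext hzb
    exact ⟨z, hz, hpz ▸ hb.trans_le (min_le_right _ _), hzt ▸ htk, hbno z hz hpz⟩
  choose z hz hzp hzW hzx using hseq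
  have hlim := tendsto_one_div_add_atTop_nhds_zero_nat (𝕜 := ℝ)
  have hpl : Filter.Tendsto (fun k => p (z k)) Filter.atTop (nhds (p x)) :=
    tendsto_iff_dist_tendsto_zero.2
      (squeeze_zero (fun _ => dist_nonneg) (fun k => (hzp k).le) hlim)
  have hWl0 : Filter.Tendsto (fun k => MvPolynomial.eval (z k) W) Filter.atTop (nhds 0) :=
    squeeze_zero_norm (fun k => (hzW k).le) hlim
  have hbdd (i : Fin n) : ∃ R, ∀ k, ‖z k i‖ ≤ R := by
    have hc : Continuous fun b : Fin d → ℂ => 1 + ∑ m ∈ Finset.range (G (MvPolynomial.X i)).natDegree,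
        ‖MvPolynomial.eval b ((G (MvPolynomial.X i)).coeff m)‖ :=
      continuous_const.add (continuous_finsetSum _ fun m _ =>
        (MvPolynomial.continuous_eval _).norm)
    obtain ⟨R, hR⟩ := ((hc.tendsto _).comp hpl).bddAbove_range
    refine ⟨R, fun k => ?_⟩
    have hm := (hG (MvPolynomial.X i)).1
    have := (hm.map (MvPolynomial.eval (p (z k)))).norm_root_le
      (by simpa using (hG (MvPolynomial.X i)).2.1 (z k) (hz k) : _ = (0 : ℂ)) (t := z k i)
    rw [hm.natDegree_map] at this
    simp only [Polynomial.coeff_map] at this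
    exact this.trans (hR ⟨k, rfl⟩)
  choose R hR using hbdd
  obtain ⟨a, -, φ, hφ, hφa⟩ := tendsto_subseq_of_bounded
    (s := Set.univ.pi fun i => Metric.closedBall (0 : ℂ) (R i))
    (Bornology.IsBounded.pi fun i => Metric.isBounded_closedBall) (x := z)
    (fun k i _ => by simpa using hR i k)
  have haX : a ∈ MvPolynomial.zeroLocus ℂ P :=
    hclosed.mem_of_tendsto hφa (Filter.Eventually.of_forall fun k => hz _)
  have hap : p a = p x := tendsto_nhds_unique ((hpc.tendsto a).comp hφa)
    (hpl.comp hφ.tendsto_atTop)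
  have haW : MvPolynomial.eval a W = 0 := tendsto_nhds_unique
    (((MvPolynomial.continuous_eval W).tendsto a).comp hφa) (hWl0.comp hφ.tendsto_atTop)
  have hax : a = x := hW a ⟨haX, hap⟩ haW
  subst hax
  have := le_of_tendsto_of_tendsto' tendsto_const_nhds (tendsto_iff_dist_tendsto_zero.1 hφa)
    fun k => hzx (φ k)
  linarith

/-- The points of an irreducible affine variety at which no coordinate is real are dense, if no
coordinate function is constant. -/
theorem exists_mem_zeroLocus_forall_im_ne_zero {n : ℕ} (P : Ideal (MvPolynomial (Fin n) ℂ))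
    [P.IsPrime] (hP : ∀ (i : Fin n) (t : ℂ), MvPolynomial.X i - MvPolynomial.C t ∉ P)
    {x : Fin n → ℂ} (hx : x ∈ MvPolynomial.zeroLocus ℂ P) {ε : ℝ} (hε : 0 < ε) :
    ∃ x' ∈ MvPolynomial.zeroLocus ℂ P, dist x' x < ε ∧ ∀ i, (x' i).im ≠ 0 := by
  classical
  suffices h : ∀ s : Finset (Fin n), ∃ x' ∈ MvPolynomial.zeroLocus ℂ P, dist x' x < ε ∧
      ∀ i ∈ s, (x' i).im ≠ 0 by
    obtain ⟨x', hx', hd, hi⟩ := h Finset.univ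
    exact ⟨x', hx', hd, fun i => hi i (Finset.mem_univ i)⟩
  intro s
  induction s using Finset.induction_on with
  | empty => exact ⟨x, hx, by simpa using hε, by simp⟩
  | insert i s _ ih =>
    obtain ⟨y, hy, hd, hi⟩ := ih
    have hev : ∀ᶠ z in nhds y, dist z x < ε ∧ ∀ j ∈ s, (z j).im ≠ 0 := by
      refine Filter.Eventually.and ?_ ?_
      · exact (by fun_prop : ContinuousAt (fun z => dist z x) y).eventually_lt_const hd
      · exact (Filter.eventually_all_finset s).2 fun j hj =>
          (Complex.continuous_im.comp (continuous_apply j)).continuousAt.eventually_ne (hi j hj)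
    obtain ⟨δ, hδ, hball⟩ := Metric.eventually_nhds_iff.1 hev
    obtain ⟨z, hz, hzy, hzi⟩ :=
      exists_mem_zeroLocus_im_ne_zero P (MvPolynomial.X i) (hP i) hy hδ
    refine ⟨z, hz, (hball hzy).1, fun j hj => ?_⟩
    rcases Finset.mem_insert.1 hj with rfl | hj
    · simpa using hzi
    · exact (hball hzy).2 j hj

/-- A matrix with positive maximal minors has full rank. -/
theorem AllMinorsPos.rank_eq {c n : ℕ} (h : c ≤ n) {A : Matrix (Fin c) (Fin n) ℝ}
    (hA : AllMinorsPos A) : A.rank = c := by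
  refine le_antisymm (by simpa using A.rank_le_height) ?_
  have hdet := hA (Fin.castLE h) (Fin.strictMono_castLE h)
  have hr := Matrix.rank_of_isUnit _ ((Matrix.isUnit_iff_isUnit_det _).2 hdet.ne'.isUnit)
  rw [Fintype.card_fin] at hr
  calc c = _ := hr.symm
    _ ≤ A.rank := Matrix.rank_submatrix_le _ _ _

/-- Nearby vectors to a nonzero vector of a positive subspace lie in positive subspaces. -/
theorem IsPositiveSubspace.exists_nhds {c n : ℕ} (h : c ≤ n) {L : Submodule ℝ (Fin n → ℝ)}
    (hL : IsPositiveSubspace c L) {v : Fin n → ℝ} (hv : v ∈ L) (hv0 : v ≠ 0) :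
    ∀ᶠ v' in nhds v, ∃ L', IsPositiveSubspace c L' ∧ v' ∈ L' := by
  obtain ⟨A, -, rfl, hA⟩ := hL
  obtain ⟨y, hy⟩ := (Submodule.mem_span_range_iff_exists_fun ℝ).1 hv
  obtain ⟨k, hk⟩ : ∃ k, y k ≠ 0 := by
    by_contra! hy0
    exact hv0 (by simp [← hy, hy0])
  let B : (Fin n → ℝ) → Matrix (Fin c) (Fin n) ℝ :=
    fun v' => A + Matrix.of (Pi.single k ((y k)⁻¹ • (v' - v)))
  have hBv : B v = A := by simp [B]
  have hB : Continuous B := by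
    refine continuous_const.add ?_
    refine (continuous_single (A := fun _ : Fin c => Fin n → ℝ) k).comp ?_
    fun_prop
  have hev : ∀ᶠ v' in nhds v, AllMinorsPos (B v') := by
    refine Filter.eventually_all.2 fun s => ?_
    by_cases hs : StrictMono s
    · have hc : Continuous fun v' => ((B v').submatrix id s).det :=
        (hB.matrix_submatrix id s).matrix_det
      filter_upwards [hc.continuousAt.eventually_const_lt (u := 0)
        (by simpa [hBv] using hA s hs)] with v' hv' _ using hv'
    · exact Filter.Eventually.of_forall fun v' h => absurd h hs
  filter_upwards [hev] with v' hv'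
  refine ⟨_, ⟨B v', hv'.rank_eq h, rfl, hv'⟩, (Submodule.mem_span_range_iff_exists_fun ℝ).2 ⟨y, ?_⟩⟩
  have : ∀ i, B v' i = A i + (Pi.single k ((y k)⁻¹ • (v' - v)) : Fin c → Fin n → ℝ) i :=
    fun i => rfl
  simp only [this, smul_add, Finset.sum_add_distrib, hy]
  rw [Finset.sum_eq_single k (by intro i _ hi; simp [hi]) (by simp)]
  simp [hk]

/-- Let `P` be a prime ideal whose zero locus `X` has no coordinate function
constant on it.  Then `X` is positively hyperbolic of codimension `c` iff for every positive
`c`-dimensional subspace `L ⊆ ℝⁿ` and every `x ∈ X` with all coordinates of `Im x` nonzero,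
`Im x ∉ L`. -/
theorem stmt2 {n c : ℕ} (hc1 : 1 ≤ c) (hc2 : c ≤ n - 1)
    (P : Ideal (MvPolynomial (Fin n) ℂ)) (hP : P.IsPrime)
    (X : Set (Fin n → ℂ))
    (hX : X = {z : Fin n → ℂ | ∀ p ∈ P, MvPolynomial.eval z p = 0})
    (hcoord : ∀ (i : Fin n) (a : ℂ), MvPolynomial.X i - MvPolynomial.C a ∉ P) :
    PosHyperbolic c X ↔
      ∀ L : Submodule ℝ (Fin n → ℝ), IsPositiveSubspace c L →
        ∀ x ∈ X, (∀ i, (x i).im ≠ 0) → imPart x ∉ L := by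
  subst hX
  have hXP : {z : Fin n → ℂ | ∀ p ∈ P, MvPolynomial.eval z p = 0} =
      MvPolynomial.zeroLocus ℂ P := by
    ext z; simp [MvPolynomial.aeval_eq_eval]
  rw [hXP]
  constructor
  · intro h L hL x hx hne hmem
    exact h L hL x hx ⟨hmem, fun h0 => hne ⟨0, by omega⟩ (congrFun h0 _)⟩
  · rintro h L hL x hx ⟨hmem, hne⟩
    have hcont : Continuous (imPart : (Fin n → ℂ) → Fin n → ℝ) :=
      continuous_pi fun i => Complex.continuous_im.comp (continuous_apply i)
    obtain ⟨ε, hε, hball⟩ := Metric.eventually_nhds_iff.1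
      (hcont.continuousAt.eventually (hL.exists_nhds (by omega) hmem hne))
    obtain ⟨x', hx', hd, hi⟩ := exists_mem_zeroLocus_forall_im_ne_zero P hcoord hx hε
    obtain ⟨L', hL', hmem'⟩ := hball hd
    exact h L' hL' x' hx' hi hmem'
end

section
/- For any integers 1 ≤ i_1 < i_2 < … < i_k ≤ n, there exists a choice of signs σ ∈ {+1, −1}^k such that every z ∈ ℝ^n satisfying sign(z_{i_j}) = σ_j for all j = 1, …, k (in particular z_{i_j} ≠ 0) has varbar(z) ≤ n − k. -/
theorem exists_mul_succ_neg_of_mul_neg {v : ℕ → ℝ} (hv : ∀ i, v i ≠ 0) {a b : ℕ} (hab : a < b)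
    (h : v a * v b < 0) : ∃ t, a ≤ t ∧ t < b ∧ v t * v (t + 1) < 0 := by
  induction b, hab using Nat.le_induction with
  | base => exact ⟨a, le_rfl, Nat.lt_succ_self a, h⟩
  | succ b hab ih =>
    by_cases hb : v a * v b < 0
    · obtain ⟨t, hat, htb, ht⟩ := ih hb
      exact ⟨t, hat, htb.trans b.lt_succ_self, ht⟩
    · have hpos : 0 < v a * v b :=
        lt_of_le_of_ne (not_lt.mp hb) (mul_ne_zero (hv a) (hv b)).symm
      refine ⟨b, (Nat.lt_of_succ_le hab).le, b.lt_succ_self, ?_⟩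
      by_contra hcon
      have hmul := mul_nonneg hpos.le (not_lt.mp hcon)
      have hsq : 0 < v b ^ 2 := by have := hv b; positivity
      nlinarith [mul_neg_of_pos_of_neg hsq h]

/-- An alternating subsequence of a nowhere zero sequence has at most as many sign changes as
there are consecutive pairs of opposite signs. -/
theorem le_card_filter_mul_succ_neg {v : ℕ → ℝ} (hv : ∀ i, v i ≠ 0) {m n : ℕ}
    (s : Fin (m + 1) → Fin n) (hs : StrictMono s)
    (h : ∀ j : Fin m, v (s j.castSucc) * v (s j.succ) < 0) :
    m ≤ ((Finset.range (n - 1)).filter fun t ↦ v t * v (t + 1) < 0).card := by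
  choose f hf₁ hf₂ hf₃ using fun j : Fin m ↦
    exists_mul_succ_neg_of_mul_neg hv (Fin.lt_def.mp (hs j.castSucc_lt_succ)) (h j)
  have hf : StrictMono f := fun i j hij ↦ by
    have hle : s i.succ ≤ s j.castSucc := hs.monotone (Fin.succ_le_castSucc_iff.mpr hij)
    exact (hf₂ i).trans_le ((Fin.le_def.mp hle).trans (hf₁ j))
  have hcard := Finset.card_le_card_of_injOn
    (s := Finset.univ) (t := (Finset.range (n - 1)).filter fun t ↦ v t * v (t + 1) < 0) f
    (fun j _ ↦ by
      have := hf₂ j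
      have := (s j.succ).isLt
      simp only [Finset.coe_filter, Finset.mem_range, Set.mem_ofPred_eq]
      exact ⟨by omega, hf₃ j⟩)
    hf.injective.injOn
  simpa using hcard

/-- The sign changes of a nowhere zero sequence of length `n` and those of the sequence
`i ↦ (-1) ^ i * v i` number at most `n - 1` altogether. -/
theorem add_le_of_alternating {v : ℕ → ℝ} (hv : ∀ i, v i ≠ 0) {m l n : ℕ}
    (s : Fin (m + 1) → Fin n) (hs : StrictMono s)
    (h : ∀ j : Fin m, v (s j.castSucc) * v (s j.succ) < 0)
    (r : Fin (l + 1) → Fin n) (hr : StrictMono r)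
    (h' : ∀ j : Fin l, (-1) ^ (r j.castSucc : ℕ) * v (r j.castSucc) *
      ((-1) ^ (r j.succ : ℕ) * v (r j.succ)) < 0) :
    m + l ≤ n - 1 := by
  have hm := le_card_filter_mul_succ_neg hv s hs h
  have hl := le_card_filter_mul_succ_neg (v := fun i ↦ (-1) ^ i * v i)
    (fun i ↦ mul_ne_zero (by simp) (hv i)) r hr h'
  have hdisj : Disjoint ((Finset.range (n - 1)).filter fun t ↦ v t * v (t + 1) < 0)
      ((Finset.range (n - 1)).filter fun t ↦
        (-1) ^ t * v t * ((-1) ^ (t + 1) * v (t + 1)) < 0) := by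
    refine Finset.disjoint_filter.mpr fun t _ ht ht' ↦ ?_
    rcases neg_one_pow_eq_or ℝ t with ht₂ | ht₂ <;> rw [pow_succ, ht₂] at ht' <;> linarith
  have hsub := Finset.card_le_card (Finset.union_subset (Finset.filter_subset
    (fun t ↦ v t * v (t + 1) < 0) (Finset.range (n - 1))) (Finset.filter_subset
    (fun t ↦ (-1) ^ t * v t * ((-1) ^ (t + 1) * v (t + 1)) < 0) (Finset.range (n - 1))))
  rw [Finset.card_union_of_disjoint hdisj, Finset.card_range] at hsub
  omega

/-- For any increasing indices `i₁ < ⋯ < i_k` in `[n]` there is a choice of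
signs `σ ∈ {±1}^k` such that every `z ∈ ℝⁿ` with `sign (z_{i_j}) = σ_j` for all `j` satisfies
`varbar z ≤ n - k`. -/
theorem stmt3 {n k : ℕ} (idx : Fin k → Fin n) (hidx : StrictMono idx) :
    ∃ σ : Fin k → ℝ, (∀ j, σ j = 1 ∨ σ j = -1) ∧
      ∀ z : Fin n → ℝ, (∀ j, Real.sign (z (idx j)) = σ j) → varbar z ≤ n - k := by
  refine ⟨fun j ↦ (-1) ^ ((idx j : ℕ) + j), fun j ↦ neg_one_pow_eq_or ℝ _, fun z hz ↦ ?_⟩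
  beta_reduce at hz
  refine csSup_le' ?_
  rintro _ ⟨w, hw, rfl⟩
  refine csSup_le' ?_
  rintro m ⟨s, hs, hsw⟩
  cases k with
  | zero =>
    have := Fintype.card_le_of_injective s hs.injective
    simp only [Fintype.card_fin] at this
    omega
  | succ l =>
    have hpos : ∀ j, 0 < (-1) ^ ((idx j : ℕ) + j) * w (idx j) := fun j ↦ by
      have hzj : z (idx j) ≠ 0 := fun h ↦ by
        have := hz j
        rw [h, Real.sign_zero] at this
        exact pow_ne_zero _ (by norm_num) this.symm
      rw [hw _ hzj, ← hz j]
      exact Real.sign_mul_pos_of_ne_zero _ hzj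
    let v : ℕ → ℝ := fun i ↦ if h : i < n then (if w ⟨i, h⟩ = 0 then 1 else w ⟨i, h⟩) else 1
    have hv : ∀ i, v i ≠ 0 := fun i ↦ by
      dsimp only [v]
      split_ifs <;> simp_all
    have hvw : ∀ i : Fin n, w i ≠ 0 → v i = w i := fun i hi ↦ by simp [v, hi]
    have hn := (idx 0).isLt
    have hle := add_le_of_alternating hv s hs
      (fun j ↦ by
        have hne := mul_ne_zero_iff.mp (hsw j).ne
        rw [hvw _ hne.1, hvw _ hne.2]
        exact hsw j) idx hidx
      (fun j ↦ by
        have ha := hpos j.castSucc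
        have hb := hpos j.succ
        rw [hvw _ (right_ne_zero_of_mul ha.ne'), hvw _ (right_ne_zero_of_mul hb.ne')]
        have hab := mul_pos ha hb
        rw [Fin.val_castSucc, Fin.val_succ, pow_add, pow_add, pow_succ] at hab
        rcases neg_one_pow_eq_or ℝ (j : ℕ) with hj | hj <;> rw [hj] at hab <;> linarith)
    omega
end

section
/- Let L ⊆ ℂ^n be a complex linear subspace of dimension d ≤ n−1 that is positively hyperbolic of codimension n−d. Then the matroid of L is a positroid: there exists a real d × n matrix B of rank d, all of whose d × d minors are nonnegative, such that for every subset S ⊆ [n], the columns of B indexed by S are linearly dependent if and only if there exists a nonzero vector c ∈ ℂ^n supported on S (c_i = 0 for i ∉ S) with Σ_i c_i x_i = 0 for all x ∈ L. -/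
open Matrix

/-- The sign of the permutation attached to a shuffle of two increasing sequences. -/
theorem sign_shuffle {d c : ℕ} (e : Fin d ⊕ Fin c ≃ Fin (d + c))
    (hl : StrictMono fun a => e (Sum.inl a)) (hr : StrictMono fun b => e (Sum.inr b)) :
    Equiv.Perm.sign (finSumFinEquiv.symm.trans e) =
      ∏ a : Fin d, (-1 : ℤˣ) ^ ((e (Sum.inl a) : ℕ) + a) := by
  have hcard : ∀ a : Fin d, (Finset.univ.filter
      fun b : Fin c => e (Sum.inr b) < e (Sum.inl a)).card + a = (e (Sum.inl a) : ℕ) := by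
    intro a
    have h1 : (Finset.univ.filter fun x => x < e (Sum.inl a)).card = (e (Sum.inl a) : ℕ) := by
      rw [Finset.filter_gt_eq_Iio, Fin.card_Iio]
    rw [← h1, Finset.card_filter (fun x => x < e (Sum.inl a)), ← Equiv.sum_comp e,
      Fintype.sum_sum_type, ← Finset.card_filter, ← Finset.card_filter]
    have h2 : (Finset.univ.filter fun x => e (Sum.inl x) < e (Sum.inl a)) = Finset.Iio a := by
      ext x
      simp [hl.lt_iff_lt]
    rw [h2, Fin.card_Iio, add_comm]
  rw [Equiv.Perm.sign_eq_prod_prod_Ioi]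
  have h3 : ∀ i : Fin (d + c), Finset.Ioi i = Finset.univ.filter fun j => i < j := by
    intro i
    ext j
    simp
  simp only [h3, Finset.prod_filter, Fin.prod_univ_add]
  have h4 : ∀ (a : Fin d) (b : Fin c), Fin.castAdd c a < Fin.natAdd d b := fun a b => by
    simp [Fin.lt_def]
    omega
  have h5 : ∀ (a : Fin d) (b : Fin c), ¬ Fin.natAdd d b < Fin.castAdd c a :=
    fun a b => (h4 a b).not_gt
  have h6 : ∀ (a a' : Fin d), (if Fin.castAdd c a < Fin.castAdd c a' then
      (if e (Sum.inl a) < e (Sum.inl a') then (1 : ℤˣ) else -1) else 1) = 1 := by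
    intro a a'
    split_ifs with h h'
    · rfl
    · exact absurd (hl (show a < a' from h)) h'
    · rfl
  have h7 : ∀ (b b' : Fin c), (if Fin.natAdd d b < Fin.natAdd d b' then
      (if e (Sum.inr b) < e (Sum.inr b') then (1 : ℤˣ) else -1) else 1) = 1 := by
    intro a a'
    split_ifs with h h'
    · rfl
    · exact absurd (hr (by simpa using h)) h'
    · rfl
  simp only [Equiv.trans_apply, finSumFinEquiv_symm_apply_castAdd,
    finSumFinEquiv_symm_apply_natAdd, h4, h5, h6, h7, if_true, if_false,
    Finset.prod_const_one, one_mul, mul_one]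
  refine Finset.prod_congr rfl fun a _ => ?_
  have h8 : ∀ b : Fin c, (if e (Sum.inl a) < e (Sum.inr b) then (1 : ℤˣ) else -1) =
      if e (Sum.inr b) < e (Sum.inl a) then -1 else 1 := by
    intro b
    have : e (Sum.inl a) ≠ e (Sum.inr b) := by simp
    rcases lt_or_gt_of_ne this with h | h
    · simp [h, h.not_gt]
    · simp [h, h.not_gt]
  simp only [h8]
  rw [Finset.prod_ite, Finset.prod_const, Finset.prod_const_one, mul_one]
  have h9 := hcard a
  rw [← h9, add_assoc, pow_add, ← two_mul, pow_mul]
  simp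

/-- Determinant of a stacked square matrix whose lower block vanishes on the columns `e ∘ inl`. -/
theorem det_fromRows_of_shuffle {d c : ℕ} (e : Fin d ⊕ Fin c ≃ Fin (d + c))
    (hl : StrictMono fun a => e (Sum.inl a)) (hr : StrictMono fun b => e (Sum.inr b))
    (M : Matrix (Fin d) (Fin (d + c)) ℝ) (A : Matrix (Fin c) (Fin (d + c)) ℝ)
    (hA : ∀ i a, A i (e (Sum.inl a)) = 0) :
    ((fromRows M A).submatrix id finSumFinEquiv).det =
      (∏ a : Fin d, (-1 : ℝ) ^ ((e (Sum.inl a) : ℕ) + a)) *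
        ((M.submatrix id fun a => e (Sum.inl a)).det *
          (A.submatrix id fun b => e (Sum.inr b)).det) := by
  set N := (fromRows M A).submatrix id finSumFinEquiv with hN
  have hblock : (N.submatrix id (e.trans finSumFinEquiv.symm)) =
      fromBlocks (M.submatrix id fun a => e (Sum.inl a)) (M.submatrix id fun b => e (Sum.inr b))
        0 (A.submatrix id fun b => e (Sum.inr b)) := by
    ext (i | i) (j | j) <;> simp [hN, hA]
  have hsign : Equiv.Perm.sign (e.trans finSumFinEquiv.symm) =
      ∏ a : Fin d, (-1 : ℤˣ) ^ ((e (Sum.inl a) : ℕ) + a) := by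
    rw [← sign_shuffle e hl hr,
      ← Equiv.Perm.sign_symm_trans_trans (e.trans finSumFinEquiv.symm) finSumFinEquiv]
    congr 1
    ext x
    simp
  have h := det_permute' (e.trans finSumFinEquiv.symm) N
  rw [hblock, det_fromBlocks_zero₂₁, hsign] at h
  rw [h, ← mul_assoc]
  have hsq : (∏ a : Fin d, (-1 : ℝ) ^ ((e (Sum.inl a) : ℕ) + a)) *
      (((∏ a : Fin d, (-1 : ℤˣ) ^ ((e (Sum.inl a) : ℕ) + a) : ℤˣ) : ℤ) : ℝ) = 1 := by
    push_cast
    rw [← Finset.prod_mul_distrib]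
    refine Finset.prod_eq_one fun a _ => ?_
    rw [← mul_pow]
    simp
  rw [hsq, one_mul]

/-- The Vandermonde matrix with nodes `0, …, n - 1` and columns rescaled by `w`. -/
def weightedVandermonde {n : ℕ} (c : ℕ) (w : Fin n → ℝ) : Matrix (Fin c) (Fin n) ℝ :=
  of fun i j => w j * (j : ℝ) ^ (i : ℕ)

theorem det_weightedVandermonde_submatrix {n c : ℕ} (w : Fin n → ℝ) (s : Fin c → Fin n) :
    ((weightedVandermonde c w).submatrix id s).det =
      (∏ k, w (s k)) * (vandermonde fun k => (s k : ℝ)).det := by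
  rw [← det_transpose (vandermonde _), ← det_mul_row]
  rfl

theorem det_vandermonde_pos {n c : ℕ} {s : Fin c → Fin n} (hs : StrictMono s) :
    0 < (vandermonde fun k => (s k : ℝ)).det := by
  rw [det_vandermonde]
  refine Finset.prod_pos fun i _ => Finset.prod_pos fun j hj => ?_
  have : (s i : ℕ) < s j := hs (Finset.mem_Ioi.mp hj)
  have : ((s i : ℕ) : ℝ) < (s j : ℕ) := by exact_mod_cast this
  linarith

theorem allMinorsPos_weightedVandermonde {n : ℕ} (c : ℕ) {w : Fin n → ℝ} (hw : ∀ j, 0 < w j) :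
    AllMinorsPos (weightedVandermonde c w) := by
  intro s hs
  rw [det_weightedVandermonde_submatrix]
  exact mul_pos (Finset.prod_pos fun k _ => hw _) (det_vandermonde_pos hs)

/-- The rows of a matrix with a nonzero maximal minor are linearly independent. -/
theorem linearIndependent_rows_of_minor_ne_zero {n c : ℕ} (A : Matrix (Fin c) (Fin n) ℝ)
    (s : Fin c → Fin n) (h : (A.submatrix id s).det ≠ 0) : LinearIndependent ℝ fun i => A i := by
  have h1 : LinearIndependent ℝ (A.submatrix id s).row :=
    linearIndependent_rows_of_det_ne_zero h
  exact LinearIndependent.of_comp (LinearMap.funLeft ℝ ℝ s) h1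

theorem AllMinorsPos.linearIndependent {n c : ℕ} (hc : c ≤ n) {A : Matrix (Fin c) (Fin n) ℝ}
    (h : AllMinorsPos A) : LinearIndependent ℝ fun i => A i :=
  linearIndependent_rows_of_minor_ne_zero A _ (h _ (Fin.strictMono_castLE hc)).ne'

theorem AllMinorsPos.isPositiveSubspace {n c : ℕ} (hc : c ≤ n) {A : Matrix (Fin c) (Fin n) ℝ}
    (h : AllMinorsPos A) : IsPositiveSubspace c (Submodule.span ℝ (Set.range fun i => A i)) :=
  ⟨A, by simpa using (h.linearIndependent hc).rank_matrix, rfl, h⟩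

/-- Complexification preserves linear independence of real vectors. -/
theorem linearIndependent_ofReal {ι : Type*} [Fintype ι] {n : ℕ} {v : ι → Fin n → ℝ}
    (hv : LinearIndependent ℝ v) : LinearIndependent ℂ fun i j => (v i j : ℂ) := by
  rw [Fintype.linearIndependent_iff] at hv ⊢
  intro g hg i
  have hj : ∀ j, ∑ i, g i * (v i j : ℂ) = 0 := fun j => by
    simpa [Finset.sum_apply] using congrFun hg j
  apply Complex.ext
  · refine hv (fun i => (g i).re) ?_ i
    ext j
    simpa [Finset.sum_apply] using congrArg Complex.re (hj j)
  · refine hv (fun i => (g i).im) ?_ i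
    ext j
    simpa [Finset.sum_apply] using congrArg Complex.im (hj j)

/-- The real points of a complex subspace of `ℂⁿ`. -/
def realPoints {n : ℕ} (L : Submodule ℂ (Fin n → ℂ)) : Submodule ℝ (Fin n → ℝ) where
  carrier := {x | (fun j => (x j : ℂ)) ∈ L}
  add_mem' {x y} hx hy := by
    have := L.add_mem hx hy
    simpa [Pi.add_def] using this
  zero_mem' := by
    have := L.zero_mem
    simpa [Pi.zero_def] using this
  smul_mem' r x hx := by
    have := L.smul_mem (r : ℂ) hx
    simpa [Pi.smul_def] using this

/-- Coordinatewise imaginary part, as a real linear map on a complex subspace of `ℂⁿ`. -/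
def imMap {n : ℕ} (L : Submodule ℂ (Fin n → ℂ)) : L →ₗ[ℝ] (Fin n → ℝ) where
  toFun x := imPart x.1
  map_add' x y := by
    ext
    simp [imPart]
  map_smul' r x := by
    ext
    simp [imPart]

/-- Coordinatewise real part, from the real vectors of `L` to its real points. -/
def kerImMapToReal {n : ℕ} (L : Submodule ℂ (Fin n → ℂ)) :
    LinearMap.ker (imMap L) →ₗ[ℝ] realPoints L where
  toFun x := ⟨fun j => (x.1.1 j).re, by
    have hx := x.2
    rw [LinearMap.mem_ker] at hx
    have : (fun j => ((x.1.1 j).re : ℂ)) = x.1.1 := by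
      ext j
      exact Complex.ext (by simp) (by simpa [imMap, imPart] using (congrFun hx j).symm)
    change (fun j => ((x.1.1 j).re : ℂ)) ∈ L
    rw [this]
    exact x.1.2⟩
  map_add' x y := by
    ext
    simp
  map_smul' r x := by
    ext
    simp

theorem kerImMapToReal_injective {n : ℕ} (L : Submodule ℂ (Fin n → ℂ)) :
    Function.Injective (kerImMapToReal L) := by
  intro x y h
  ext j
  have hx := congrFun (LinearMap.mem_ker.mp x.2) j
  have hy := congrFun (LinearMap.mem_ker.mp y.2) j
  have h' := congrFun (congrArg Subtype.val h) j
  simp only [imMap, imPart, LinearMap.coe_mk, AddHom.coe_mk, Pi.zero_apply] at hx hy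
  exact Complex.ext h' (hx.trans hy.symm)

/-- A `d`-dimensional positively hyperbolic subspace of codimension `c` has at least `d`
independent real points. -/
theorem le_finrank_realPoints {d c : ℕ} (L : Submodule ℂ (Fin (d + c) → ℂ))
    (hdim : Module.finrank ℂ L = d) (hL : PosHyperbolic c (L : Set (Fin (d + c) → ℂ))) :
    d ≤ Module.finrank ℝ (realPoints L) := by
  have hA := allMinorsPos_weightedVandermonde (n := d + c) c (w := fun _ => 1)
    (fun _ => one_pos)
  have hc : c ≤ d + c := Nat.le_add_left c d
  set V := Submodule.span ℝ (Set.range fun i => weightedVandermonde (n := d + c) c (fun _ => 1) i)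
    with hV
  have hVrank : Module.finrank ℝ V = c := by
    rw [hV, finrank_span_eq_card (hA.linearIndependent hc), Fintype.card_fin]
  have hdisj : Disjoint (LinearMap.range (imMap L)) V := by
    rw [Submodule.disjoint_def]
    rintro _ ⟨x, rfl⟩ hx
    by_contra hne
    exact hL V (hA.isPositiveSubspace hc) x.1 x.2 ⟨hx, hne⟩
  have h1 := Submodule.finrank_add_finrank_le_of_disjoint hdisj
  have h2 := (imMap L).finrank_range_add_finrank_ker
  have h3 : Module.finrank ℝ L = 2 * d := by
    rw [finrank_real_of_complex, hdim]
  have h4 := LinearMap.finrank_le_finrank_of_injective (kerImMapToReal_injective L)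
  rw [hVrank, Module.finrank_fin_fun] at h1
  omega

/-- A positively hyperbolic subspace of complementary codimension is spanned by real vectors. -/
theorem exists_real_basis {d c : ℕ} (L : Submodule ℂ (Fin (d + c) → ℂ))
    (hdim : Module.finrank ℂ L = d) (hL : PosHyperbolic c (L : Set (Fin (d + c) → ℂ))) :
    ∃ M : Matrix (Fin d) (Fin (d + c)) ℝ, LinearIndependent ℝ (fun i => M i) ∧
      L = Submodule.span ℂ (Set.range fun i j => (M i j : ℂ)) := by
  obtain ⟨v, hv⟩ := exists_linearIndependent_of_le_finrank (le_finrank_realPoints L hdim hL)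
  have hv' : LinearIndependent ℝ fun i => (v i : Fin (d + c) → ℝ) :=
    hv.map' (realPoints L).subtype (Submodule.ker_subtype _)
  refine ⟨of fun i => (v i).1, hv', (Submodule.eq_of_le_of_finrank_eq ?_ ?_).symm⟩
  · rw [Submodule.span_le]
    rintro _ ⟨i, rfl⟩
    exact (v i).2
  · rw [hdim]
    have := finrank_span_eq_card (linearIndependent_ofReal hv')
    rw [Fintype.card_fin] at this
    exact this

/-- Stacking a real basis of a positively hyperbolic subspace on a positive matrix gives an
invertible matrix. -/
theorem PosHyperbolic.det_fromRows_ne_zero {d c : ℕ} {L : Submodule ℂ (Fin (d + c) → ℂ)}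
    (hL : PosHyperbolic c (L : Set (Fin (d + c) → ℂ)))
    {M : Matrix (Fin d) (Fin (d + c)) ℝ} (hM : LinearIndependent ℝ fun i => M i)
    (hML : ∀ i, (fun j => (M i j : ℂ)) ∈ L)
    {A : Matrix (Fin c) (Fin (d + c)) ℝ} (hA : AllMinorsPos A) :
    ((fromRows M A).submatrix id finSumFinEquiv).det ≠ 0 := by
  have hc : c ≤ d + c := Nat.le_add_left c d
  intro h0
  obtain ⟨u, hu, hu0⟩ := exists_vecMul_eq_zero_iff.mpr h0
  set x : Fin (d + c) → ℝ := ∑ i, u (Sum.inl i) • M i with hx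
  set y : Fin (d + c) → ℝ := ∑ i, u (Sum.inr i) • A i with hy
  have hxy : x + y = 0 := by
    ext j
    have := congrFun hu0 (finSumFinEquiv.symm j)
    simpa [vecMul, dotProduct, hx, hy, Finset.sum_apply] using this
  have hyV : y ∈ Submodule.span ℝ (Set.range fun i => A i) :=
    Submodule.sum_mem _ fun i _ => Submodule.smul_mem _ _ (Submodule.subset_span ⟨i, rfl⟩)
  have hxV : x ∈ Submodule.span ℝ (Set.range fun i => A i) := by
    rw [eq_neg_of_add_eq_zero_left hxy]
    exact Submodule.neg_mem _ hyV
  have hxL : (fun j => Complex.I * (x j : ℂ)) ∈ L := by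
    have : ∑ i, (Complex.I * (u (Sum.inl i) : ℂ)) • (fun j => (M i j : ℂ)) ∈ L :=
      Submodule.sum_mem _ fun i _ => Submodule.smul_mem _ _ (hML i)
    convert this using 1
    ext j
    simp [hx, Finset.sum_apply, Finset.mul_sum, mul_assoc]
  have him : imPart (fun j => Complex.I * (x j : ℂ)) = x := by
    ext j
    simp [imPart]
  have hx0 : x = 0 := by
    by_contra hne
    refine hL _ (hA.isPositiveSubspace hc) _ hxL ?_
    rw [him]
    exact ⟨hxV, hne⟩
  have hy0 : y = 0 := by simpa [hx0] using hxy
  apply hu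
  ext (i | i)
  · exact Fintype.linearIndependent_iff.mp hM (fun i => u (Sum.inl i)) hx0 i
  · exact Fintype.linearIndependent_iff.mp (hA.linearIndependent hc)
      (fun i => u (Sum.inr i)) hy0 i

theorem continuous_det_fromRows_weightedVandermonde {d c : ℕ}
    (M : Matrix (Fin d) (Fin (d + c)) ℝ) :
    Continuous fun w : Fin (d + c) → ℝ =>
      ((fromRows M (weightedVandermonde c w)).submatrix id finSumFinEquiv).det := by
  refine Continuous.matrix_det (continuous_matrix fun i j => ?_)
  rcases i with i | i
  · simpa using continuous_const
  · simp only [submatrix_apply, id, fromRows_apply_inr, weightedVandermonde, of_apply]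
    fun_prop

/-- A continuous function without zeros on the open positive orthant has constant weak sign on
the closed orthant. -/
theorem mul_nonneg_of_ne_zero_on_pos {n : ℕ} {f : (Fin n → ℝ) → ℝ} (hf : Continuous f)
    (h0 : ∀ w, (∀ j, 0 < w j) → f w ≠ 0) {w w' : Fin n → ℝ} (hw : ∀ j, 0 ≤ w j)
    (hw' : ∀ j, 0 ≤ w' j) : 0 ≤ f w * f w' := by
  have hpos : ∀ w w' : Fin n → ℝ, (∀ j, 0 < w j) → (∀ j, 0 < w' j) → 0 ≤ f w * f w' := by
    have hlt : ∀ w w' : Fin n → ℝ, (∀ j, 0 < w j) → (∀ j, 0 < w' j) → f w < 0 → ¬ 0 < f w' := by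
      intro w w' hw hw' h h'
      have hconv : Convex ℝ {w : Fin n → ℝ | ∀ j, 0 < w j} := by
        intro a ha b hb s t hs ht hst j
        simp only [Pi.add_apply, Pi.smul_apply, smul_eq_mul]
        rcases hs.eq_or_lt with rfl | hs
        · have : t = 1 := by linarith
          subst this
          simpa using hb j
        · have := mul_pos hs (ha j)
          have := mul_nonneg ht (hb j).le
          linarith
      obtain ⟨z, hz, hz0⟩ := hconv.isPreconnected.intermediate_value hw hw' hf.continuousOn
        ⟨h.le, h'.le⟩
      exact h0 z hz hz0
    intro w w' hw hw'
    rcases (h0 w hw).lt_or_gt with h | h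
    · exact mul_nonneg_of_nonpos_of_nonpos h.le (not_lt.mp (hlt w w' hw hw' h))
    · refine mul_nonneg h.le (not_lt.mp fun h' => hlt w' w hw' hw h' h)
  have hcont : Continuous fun t : ℝ => f (w + fun _ => t) * f (w' + fun _ => t) := by
    fun_prop
  have hlim : Filter.Tendsto (fun t : ℝ => f (w + fun _ => t) * f (w' + fun _ => t))
      (nhdsWithin 0 (Set.Ioi 0)) (nhds (f w * f w')) := by
    have := (hcont.tendsto 0).mono_left (nhdsWithin_le_nhds (s := Set.Ioi 0))
    have hz : (fun _ : Fin n => (0 : ℝ)) = 0 := rfl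
    simpa [hz] using this
  refine ge_of_tendsto hlim ?_
  filter_upwards [self_mem_nhdsWithin] with t ht
  exact hpos _ _ (fun j => add_pos_of_nonneg_of_pos (hw j) ht)
    (fun j => add_pos_of_nonneg_of_pos (hw' j) ht)

/-- Every increasing sequence extends to a shuffle. -/
theorem exists_shuffle {d c : ℕ} {s : Fin d → Fin (d + c)} (hs : StrictMono s) :
    ∃ e : Fin d ⊕ Fin c ≃ Fin (d + c), (∀ a, e (Sum.inl a) = s a) ∧
      StrictMono fun b => e (Sum.inr b) := by
  have h1 : (Finset.univ.image s).card = d := by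
    rw [Finset.card_image_of_injective _ hs.injective, Finset.card_fin]
  have h2 : (Finset.univ.image s)ᶜ.card = c := by
    rw [Finset.card_compl, h1, Fintype.card_fin]
    omega
  refine ⟨finSumEquivOfFinset h1 h2, fun a => ?_, ?_⟩
  · rw [finSumEquivOfFinset_inl]
    exact (congrFun (Finset.orderEmbOfFin_unique h1
      (fun x => Finset.mem_image_of_mem s (Finset.mem_univ x)) hs) a).symm
  · simp only [finSumEquivOfFinset_inr]
    exact (Finset.orderEmbOfFin _ h2).strictMono

/-- The alternated maximal minors of a real basis of a positively hyperbolic subspace all have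
the same weak sign. -/
theorem PosHyperbolic.alternated_minors_mul_nonneg {d c : ℕ}
    {L : Submodule ℂ (Fin (d + c) → ℂ)}
    (hL : PosHyperbolic c (L : Set (Fin (d + c) → ℂ)))
    {M : Matrix (Fin d) (Fin (d + c)) ℝ} (hM : LinearIndependent ℝ fun i => M i)
    (hML : ∀ i, (fun j => (M i j : ℂ)) ∈ L)
    {s t : Fin d → Fin (d + c)} (hs : StrictMono s) (ht : StrictMono t) :
    0 ≤ ((∏ a, (-1 : ℝ) ^ (s a : ℕ)) * (M.submatrix id s).det) *
      ((∏ a, (-1 : ℝ) ^ (t a : ℕ)) * (M.submatrix id t).det) := by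
  set f : (Fin (d + c) → ℝ) → ℝ := fun w =>
    ((fromRows M (weightedVandermonde c w)).submatrix id finSumFinEquiv).det with hf
  have hfne : ∀ w, (∀ j, 0 < w j) → f w ≠ 0 := fun w hw =>
    hL.det_fromRows_ne_zero hM hML (allMinorsPos_weightedVandermonde c hw)
  set ε : ℝ := ∏ a : Fin d, (-1 : ℝ) ^ (a : ℕ) with hε
  have hε2 : ε * ε = 1 := by
    rw [hε, ← Finset.prod_mul_distrib]
    exact Finset.prod_eq_one fun a _ => by rw [← mul_pow]; simp
  have key : ∀ s : Fin d → Fin (d + c), StrictMono s → ∃ w : Fin (d + c) → ℝ, (∀ j, 0 ≤ w j) ∧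
      ∃ r : ℝ, 0 < r ∧ f w = ε * ((∏ a, (-1 : ℝ) ^ (s a : ℕ)) * (M.submatrix id s).det) * r := by
    intro s hs
    obtain ⟨e, hes, her⟩ := exists_shuffle hs
    refine ⟨fun j => Sum.elim (fun _ => 0) (fun _ => 1) (e.symm j), fun j => ?_,
      (vandermonde fun b => (e (Sum.inr b) : ℝ)).det, det_vandermonde_pos her, ?_⟩
    · beta_reduce
      rcases e.symm j with a | b <;> simp
    · have hel : (fun a => e (Sum.inl a)) = s := funext hes
      simp only [hf]
      rw [det_fromRows_of_shuffle e (hel ▸ hs) her, det_weightedVandermonde_submatrix, hel]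
      · simp only [hes, pow_add, Finset.prod_mul_distrib, Equiv.symm_apply_apply, Sum.elim_inr,
          Finset.prod_const_one]
        ring
      · intro i a
        simp [weightedVandermonde]
  obtain ⟨w, hw, r, hr, hfw⟩ := key s hs
  obtain ⟨w', hw', r', hr', hfw'⟩ := key t ht
  have h := mul_nonneg_of_ne_zero_on_pos (continuous_det_fromRows_weightedVandermonde M) hfne hw hw'
  change 0 ≤ f w * f w' at h
  rw [hfw, hfw'] at h
  refine nonneg_of_mul_nonneg_left (b := r * r') ?_ (mul_pos hr hr')
  calc (0 : ℝ) ≤ _ := h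
    _ = (ε * ε) * (((∏ a, (-1 : ℝ) ^ (s a : ℕ)) * (M.submatrix id s).det) *
      ((∏ a, (-1 : ℝ) ^ (t a : ℕ)) * (M.submatrix id t).det)) * (r * r') := by ring
    _ = _ := by rw [hε2, one_mul]

/-- A signing of rows and columns turns a real basis of a positively hyperbolic subspace into a
matrix with nonnegative maximal minors. -/
theorem PosHyperbolic.exists_signing {d c : ℕ} {L : Submodule ℂ (Fin (d + c) → ℂ)}
    (hL : PosHyperbolic c (L : Set (Fin (d + c) → ℂ)))
    {M : Matrix (Fin d) (Fin (d + c)) ℝ} (hM : LinearIndependent ℝ fun i => M i)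
    (hML : ∀ i, (fun j => (M i j : ℂ)) ∈ L) :
    ∃ (δ : Fin d → ℝ) (ε : Fin (d + c) → ℝ), (∀ i, δ i ≠ 0) ∧ (∀ j, ε j ≠ 0) ∧
      AllMinorsNonneg (of fun i j => δ i * (ε j * M i j)) := by
  have hdet : ∀ (δ : Fin d → ℝ) (s : Fin d → Fin (d + c)),
      ((of fun (i : Fin d) (j : Fin (d + c)) => δ i * ((-1 : ℝ) ^ (j : ℕ) * M i j)).submatrix id s).det =
        (∏ i, δ i) * ((∏ a, (-1 : ℝ) ^ (s a : ℕ)) * (M.submatrix id s).det) := by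
    intro δ s
    rw [← det_mul_row, ← det_mul_column]
    rfl
  have hε : ∀ j : Fin (d + c), (-1 : ℝ) ^ (j : ℕ) ≠ 0 := fun j => by simp
  by_cases h : ∀ s : Fin d → Fin (d + c), StrictMono s →
      0 ≤ (∏ a, (-1 : ℝ) ^ (s a : ℕ)) * (M.submatrix id s).det
  · refine ⟨fun _ => 1, fun j => (-1) ^ (j : ℕ), fun _ => one_ne_zero, hε, fun s hs => ?_⟩
    rw [hdet, Finset.prod_const_one, one_mul]
    exact h s hs
  · push Not at h
    obtain ⟨s₀, hs₀, hneg⟩ := h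
    obtain ⟨i₀⟩ : Nonempty (Fin d) := by
      by_contra hempty
      rw [not_nonempty_iff] at hempty
      simp at hneg
      linarith
    refine ⟨Function.update (fun _ => 1) i₀ (-1), fun j => (-1) ^ (j : ℕ), fun i => ?_, hε,
      fun s hs => ?_⟩
    · by_cases hi : i = i₀
      · subst hi
        simp
      · simp [hi]
    · rw [hdet, Finset.prod_update_of_mem (Finset.mem_univ _), Finset.prod_const_one, mul_one]
      have := hL.alternated_minors_mul_nonneg hM hML hs hs₀
      have := nonpos_of_mul_nonneg_left this hneg
      linarith

/-- Columns indexed by `S` are dependent iff some nonzero vector supported on `S` lies in the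
kernel. -/
theorem not_linearIndependent_columns_iff {d n : ℕ} (B : Matrix (Fin d) (Fin n) ℝ)
    (S : Set (Fin n)) :
    (¬ LinearIndependent ℝ (fun i : S => B.transpose i.1)) ↔
      ∃ g : Fin n → ℝ, g ≠ 0 ∧ (∀ j, j ∉ S → g j = 0) ∧ ∀ i, ∑ j, g j * B i j = 0 := by
  classical
  change ¬ LinearIndepOn ℝ (fun j i => B i j) S ↔ _
  rw [linearIndepOn_iff]
  push Not
  constructor
  · rintro ⟨l, hl, hl0, hne⟩
    refine ⟨l, fun h => hne (DFunLike.coe_injective h), fun j hj => ?_, fun i => ?_⟩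
    · by_contra h
      exact hj (hl (by simpa using h))
    · have := congrFun hl0 i
      rw [Finsupp.linearCombination_apply, Finsupp.sum_fintype _ _ (by simp)] at this
      simpa [Finset.sum_apply] using this
  · rintro ⟨g, hg, hS, h0⟩
    refine ⟨Finsupp.equivFunOnFinite.symm g, ?_, ?_, fun h => hg ?_⟩
    · rw [Finsupp.mem_supported]
      intro j hj
      by_contra h
      simp [hS j h] at hj
    · ext i
      rw [Finsupp.linearCombination_apply, Finsupp.sum_fintype _ _ (by simp)]
      simpa [Finset.sum_apply] using h0 i
    · ext j
      simpa using DFunLike.congr_fun h j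

/-- A real linear system has a nonzero complex solution supported on `S` iff it has a nonzero
real one. -/
theorem exists_complex_kernel_iff_real {d n : ℕ} (M : Matrix (Fin d) (Fin n) ℝ)
    (S : Set (Fin n)) :
    (∃ g : Fin n → ℂ, g ≠ 0 ∧ (∀ j, j ∉ S → g j = 0) ∧ ∀ i, ∑ j, g j * (M i j : ℂ) = 0) ↔
      ∃ g : Fin n → ℝ, g ≠ 0 ∧ (∀ j, j ∉ S → g j = 0) ∧ ∀ i, ∑ j, g j * M i j = 0 := by
  constructor
  · rintro ⟨g, hg, hS, h0⟩
    by_cases hre : (fun j => (g j).re) = 0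
    · refine ⟨fun j => (g j).im, fun him => hg ?_, fun j hj => by simp [hS j hj], fun i => ?_⟩
      · ext j
        exact Complex.ext (congrFun hre j) (congrFun him j)
      · simpa using congrArg Complex.im (h0 i)
    · refine ⟨fun j => (g j).re, hre, fun j hj => by simp [hS j hj], fun i => ?_⟩
      simpa using congrArg Complex.re (h0 i)
  · rintro ⟨g, hg, hS, h0⟩
    refine ⟨fun j => (g j : ℂ), fun h => hg ?_, fun j hj => by simp [hS j hj], fun i => ?_⟩
    · ext j
      simpa using congrFun h j
    · have := congrArg (fun r : ℝ => (r : ℂ)) (h0 i)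
      simpa using this

/-- The main theorem with ambient dimension written as `d + c`. -/
theorem PosHyperbolic.exists_nonneg_representation {d c : ℕ} {L : Submodule ℂ (Fin (d + c) → ℂ)}
    (hdim : Module.finrank ℂ L = d) (hL : PosHyperbolic c (L : Set (Fin (d + c) → ℂ))) :
    ∃ B : Matrix (Fin d) (Fin (d + c)) ℝ, B.rank = d ∧ AllMinorsNonneg B ∧
      ∀ S : Set (Fin (d + c)),
        (¬ LinearIndependent ℝ (fun i : S => B.transpose i.1)) ↔
          ∃ cvec : Fin (d + c) → ℂ, cvec ≠ 0 ∧ (∀ i, i ∉ S → cvec i = 0) ∧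
            ∀ x ∈ L, ∑ i, cvec i * x i = 0 := by
  obtain ⟨M, hM, hspan⟩ := exists_real_basis L hdim hL
  have hML : ∀ i, (fun j => (M i j : ℂ)) ∈ L := fun i => by
    rw [hspan]
    exact Submodule.subset_span ⟨i, rfl⟩
  obtain ⟨δ, ε, hδ, hε, hB⟩ := hL.exists_signing hM hML
  refine ⟨_, ?_, hB, fun S => ?_⟩
  · have hli : LinearIndependent ℝ
        (of fun i j => δ i * (ε j * M i j) : Matrix (Fin d) (Fin (d + c)) ℝ).row := by
      rw [Fintype.linearIndependent_iff] at hM ⊢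
      intro g hg i
      refine (mul_eq_zero.mp (hM (fun i => g i * δ i) ?_ i)).resolve_right (hδ i)
      ext j
      have h := congrFun hg j
      simp only [Finset.sum_apply, Pi.smul_apply, smul_eq_mul, row, of_apply,
        Pi.zero_apply] at h ⊢
      refine (mul_eq_zero.mp (?_ : ε j * _ = 0)).resolve_left (hε j)
      rw [← h, Finset.mul_sum]
      exact Finset.sum_congr rfl fun i _ => by ring
    simpa using hli.rank_matrix
  · have hL' : ∀ g : Fin (d + c) → ℂ, (∀ x ∈ L, ∑ i, g i * x i = 0) ↔
        ∀ i, ∑ j, g j * (M i j : ℂ) = 0 := by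
      refine fun g => ⟨fun h i => h _ (hML i), fun h x hx => ?_⟩
      rw [hspan] at hx
      induction hx using Submodule.span_induction with
      | mem x hx =>
        obtain ⟨i, rfl⟩ := hx
        exact h i
      | zero => simp
      | add x y _ _ hx hy => simp [mul_add, Finset.sum_add_distrib, hx, hy]
      | smul a x _ hx =>
        have : ∑ i, g i * (a • x) i = a * ∑ i, g i * x i := by
          rw [Finset.mul_sum]
          exact Finset.sum_congr rfl fun i _ => by simp; ring
        rw [this, hx, mul_zero]
    simp only [hL']
    rw [exists_complex_kernel_iff_real, not_linearIndependent_columns_iff]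
    have hsum : ∀ (g : Fin (d + c) → ℝ) (i : Fin d),
        ∑ j, g j * (of fun i j => δ i * (ε j * M i j) : Matrix (Fin d) (Fin (d + c)) ℝ) i j =
          δ i * ∑ j, (ε j * g j) * M i j := by
      intro g i
      rw [Finset.mul_sum]
      exact Finset.sum_congr rfl fun j _ => by simp; ring
    constructor
    · rintro ⟨g, hg, hS, h0⟩
      refine ⟨fun j => ε j * g j, fun h => hg ?_, fun j hj => by simp [hS j hj], fun i => ?_⟩
      · ext j
        exact (mul_eq_zero.mp (congrFun h j)).resolve_left (hε j)
      · exact (mul_eq_zero.mp ((hsum g i).symm.trans (h0 i))).resolve_left (hδ i)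
    · rintro ⟨g, hg, hS, h0⟩
      refine ⟨fun j => (ε j)⁻¹ * g j, fun h => hg ?_, fun j hj => by simp [hS j hj], fun i => ?_⟩
      · ext j
        exact (mul_eq_zero.mp (congrFun h j)).resolve_left (inv_ne_zero (hε j))
      · rw [hsum]
        simp only [mul_inv_cancel_left₀ (hε _), h0, mul_zero]

/-- If a `d`-dimensional complex subspace `L ⊆ ℂⁿ` (with `d ≤ n-1`) is
positively hyperbolic of codimension `n - d`, then its matroid is a positroid: there is a
real `d × n` matrix `B` of rank `d` with all `d × d` minors nonnegative such that a set
`S ⊆ [n]` of columns of `B` is linearly dependent exactly when some nonzero linear form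
supported on `S` vanishes on `L`. -/
theorem stmt5 {n d : ℕ} (hd : d ≤ n - 1) (L : Submodule ℂ (Fin n → ℂ))
    (hdim : Module.finrank ℂ L = d)
    (hL : PosHyperbolic (n - d) (L : Set (Fin n → ℂ))) :
    ∃ B : Matrix (Fin d) (Fin n) ℝ, B.rank = d ∧ AllMinorsNonneg B ∧
      ∀ S : Set (Fin n),
        (¬ LinearIndependent ℝ (fun i : S => B.transpose i.1)) ↔
          ∃ cvec : Fin n → ℂ, cvec ≠ 0 ∧ (∀ i, i ∉ S → cvec i = 0) ∧
            ∀ x ∈ L, ∑ i, cvec i * x i = 0 := by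
  obtain ⟨c, rfl⟩ : ∃ c, n = d + c := ⟨n - d, by omega⟩
  rw [Nat.add_sub_cancel_left] at hL
  exact hL.exists_nonneg_representation hdim
end
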